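/- There is a unique bilinear continuous map ♯ : S(ℝ^d×ℝ^d, B(H',H'')) × S(ℝ^d×ℝ^d, B(H,H')) → S(ℝ^d×ℝ^d, B(H,H'')), the magnetic Weyl product, with Op^A(f ♯ g) = Op^A(f) ∘ Op^A(g) for all operator-valued Schwartz symbols f, g; it is given by the absolutely convergent integral (f♯g)(X) = (2π)^{−2d} ∬ e^{+iσ(X,Y+Z)} e^{+i(ε/2)σ(Y,Z)} e^{−iλγ_B(x,y,z)} (F_σ f)(Y) (F_σ g)(Z) dY dZ, where X=(x,ξ), Y=(y,η), Z=(z,ζ) ∈ ℝ^d×ℝ^d, σ((x,ξ),(y,η)) := ξ·y − x·η, F_σ f(X) := (2π)^{−d}∫ e^{+iσ(X,X')} f(X') dX' is the symplectic Fourier transform, and γ_B(x,y,z) := ε^{−1}·(flux of B through the triangle with corners x−(ε/2)(y+z), x+(ε/2)(y−z), x+(ε/2)(y+z)). In particular ♯ depends only on the magnetic field B and not on the choice of vector potential A. -/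

import Mathlib

open MeasureTheory Complex SchwartzMap
open scoped Real ENNReal NNReal

set_option maxHeartbeats 1000000
set_option synthInstance.maxHeartbeats 1000000

noncomputable section

local notation "⟪" x ", " y "⟫_ℝ" => @inner ℝ _ _ x y
local notation "⟪" x ", " y "⟫_ℂ" => @inner ℂ _ _ x y

/-- Euclidean configuration space. -/
abbrev Ed (d : ℕ) : Type := EuclideanSpace ℝ (Fin d)

/-- Line integral of the vector potential `A` along the segment `[x, y]`. -/
def lineInt {d : ℕ} (A : Ed d → Ed d) (x y : Ed d) : ℝ :=
  ∫ s in (0:ℝ)..(1:ℝ), ⟪A (x + s • (y - x)), y - x⟫_ℝ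

/-- The phase `e^{-i(y-x)·η} e^{-i(λ/ε)Γ_A(εx,εy)}` of the magnetic Weyl quantization. -/
def wPhase {d : ℕ} (ε lam : ℝ) (A : Ed d → Ed d) (x y η : Ed d) : ℂ :=
  Complex.exp (-Complex.I * ((⟪y - x, η⟫_ℝ : ℝ) : ℂ)) *
    Complex.exp (-Complex.I * (((lam / ε) * lineInt A (ε • x) (ε • y) : ℝ) : ℂ))

/-- Magnetic Weyl quantization of an operator-valued symbol (absolutely convergent version,
with the momentum integral innermost, suitable for Schwartz-class symbols). -/
def opA {d : ℕ} {H H' : Type*} [NormedAddCommGroup H] [NormedSpace ℂ H]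
    [NormedAddCommGroup H'] [NormedSpace ℂ H']
    (ε lam : ℝ) (A : Ed d → Ed d) (f : Ed d × Ed d → (H →L[ℂ] H')) (Ψ : Ed d → H) :
    Ed d → H' :=
  fun x => (((2 * Real.pi) ^ d)⁻¹ : ℝ) •
    ∫ y : Ed d, ∫ η : Ed d, wPhase ε lam A x y η • f ((ε / 2) • (x + y), η) (Ψ y)

/-- Magnetic Weyl quantization as an (iterated, oscillatory) integral with the momentum
integral outermost; this realizes the oscillatory integral for Hörmander-class symbols. -/
def opW {d : ℕ} {H H' : Type*} [NormedAddCommGroup H] [NormedSpace ℂ H]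
    [NormedAddCommGroup H'] [NormedSpace ℂ H']
    (ε lam : ℝ) (A : Ed d → Ed d) (f : Ed d × Ed d → (H →L[ℂ] H')) (Ψ : Ed d → H) :
    Ed d → H' :=
  fun x => (((2 * Real.pi) ^ d)⁻¹ : ℝ) •
    ∫ η : Ed d, ∫ y : Ed d, wPhase ε lam A x y η • f ((ε / 2) • (x + y), η) (Ψ y)

/-- Directional derivative of a phase-space function. -/
def dirD {d : ℕ} {F : Type*} [NormedAddCommGroup F] [NormedSpace ℝ F]
    (v : Ed d × Ed d) (g : Ed d × Ed d → F) : Ed d × Ed d → F :=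
  fun p => fderiv ℝ g p v

/-- Directions corresponding to the multi-indices `a` (position) and `α` (momentum). -/
def mkDirs {d : ℕ} (a α : List (Fin d)) : List (Ed d × Ed d) :=
  (a.map fun j => ((EuclideanSpace.single j (1:ℝ) : Ed d), (0 : Ed d))) ++
    α.map fun j => ((0 : Ed d), (EuclideanSpace.single j (1:ℝ) : Ed d))

/-- The iterated partial derivative `∂_x^a ∂_ξ^α f`. -/
def mDeriv {d : ℕ} {F : Type*} [NormedAddCommGroup F] [NormedSpace ℝ F]
    (a α : List (Fin d)) (f : Ed d × Ed d → F) : Ed d × Ed d → F :=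
  (mkDirs a α).foldr dirD f

/-- The Japanese bracket `⟨ξ⟩ = (1+|ξ|²)^{1/2}`. -/
def jb {d : ℕ} (ξ : Ed d) : ℝ := Real.sqrt (1 + ‖ξ‖ ^ 2)

/-- Operator-valued Hörmander class `S^m_{ρ,δ}(B(H,H'))`. -/
structure IsHormander {d : ℕ} {H H' : Type*} [NormedAddCommGroup H] [NormedSpace ℂ H]
    [NormedAddCommGroup H'] [NormedSpace ℂ H'] (m ρ δ : ℝ)
    (f : Ed d × Ed d → (H →L[ℂ] H')) : Prop where
  smooth : ContDiff ℝ (⊤ : ℕ∞) f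
  bound : ∀ a α : List (Fin d), ∃ C : ℝ, ∀ p : Ed d × Ed d,
    ‖mDeriv a α f p‖ ≤ C * jb p.2 ^ (m - ρ * (α.length : ℝ) + δ * (a.length : ℝ))

/-- `A` is smooth with polynomially bounded derivatives of all orders. -/
def IsPolyVF {d : ℕ} (A : Ed d → Ed d) : Prop :=
  ContDiff ℝ (⊤ : ℕ∞) A ∧ ∀ n : ℕ, ∃ C : ℝ, ∃ k : ℕ, ∀ x, ‖iteratedFDeriv ℝ n A x‖ ≤ C * (1 + ‖x‖) ^ k

/-- Components `B_{jl} = ∂_j A_l − ∂_l A_j` of the magnetic field `B = dA`. -/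
def Bcomp {d : ℕ} (A : Ed d → Ed d) (x : Ed d) (j l : Fin d) : ℝ :=
  fderiv ℝ (fun z => A z l) x (EuclideanSpace.single j (1:ℝ)) -
    fderiv ℝ (fun z => A z j) x (EuclideanSpace.single l (1:ℝ))

/-- The magnetic field `B = dA` is bounded with bounded derivatives of all orders. -/
def IsBoundedField {d : ℕ} (A : Ed d → Ed d) : Prop :=
  ∀ (j l : Fin d) (n : ℕ), ∃ C : ℝ, ∀ x, ‖iteratedFDeriv ℝ n (fun z => Bcomp A z j l) x‖ ≤ C


/-- The (non-magnetic) symplectic form `σ(X,Y) = ξ·y − x·η`. -/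
def symp {d : ℕ} (X Y : Ed d × Ed d) : ℝ := ⟪X.2, Y.1⟫_ℝ - ⟪X.1, Y.2⟫_ℝ

/-- The symplectic Fourier transform. -/
def fourierSymp {d : ℕ} {F : Type*} [NormedAddCommGroup F] [NormedSpace ℂ F]
    (f : Ed d × Ed d → F) (X : Ed d × Ed d) : F :=
  (((2 * Real.pi) ^ d)⁻¹ : ℝ) •
    ∫ Y : Ed d × Ed d, Complex.exp (Complex.I * ((symp X Y : ℝ) : ℂ)) • f Y

/-- Flux of the magnetic field `B = dA` through the triangle with corners `q₀, q₁, q₂`. -/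
def fluxTriangle {d : ℕ} (A : Ed d → Ed d) (q₀ q₁ q₂ : Ed d) : ℝ :=
  ∫ s in (0:ℝ)..(1:ℝ), ∫ t in (0:ℝ)..(1 - s),
    ∑ j : Fin d, ∑ l : Fin d,
      Bcomp A (q₀ + s • (q₁ - q₀) + t • (q₂ - q₀)) j l * (q₁ - q₀) j * (q₂ - q₀) l

/-- The magnetic phase `γ_B(x,y,z)` appearing in the magnetic Weyl product. -/
def gammaB {d : ℕ} (ε : ℝ) (A : Ed d → Ed d) (x y z : Ed d) : ℝ :=
  ε⁻¹ * fluxTriangle A (x - (ε / 2) • (y + z)) (x + (ε / 2) • (y - z)) (x + (ε / 2) • (y + z))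

/-- The integrand of the magnetic Weyl product. -/
def weylIntegrand {d : ℕ} {H H' H'' : Type*}
    [NormedAddCommGroup H] [NormedSpace ℂ H] [NormedAddCommGroup H'] [NormedSpace ℂ H']
    [NormedAddCommGroup H''] [NormedSpace ℂ H'']
    (ε lam : ℝ) (A : Ed d → Ed d)
    (f : Ed d × Ed d → (H' →L[ℂ] H'')) (g : Ed d × Ed d → (H →L[ℂ] H'))
    (X : Ed d × Ed d) (YZ : (Ed d × Ed d) × (Ed d × Ed d)) : H →L[ℂ] H'' :=
  (Complex.exp (Complex.I * ((symp X (YZ.1 + YZ.2) : ℝ) : ℂ)) *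
    Complex.exp (Complex.I * (((ε / 2) * symp YZ.1 YZ.2 : ℝ) : ℂ)) *
    Complex.exp (-Complex.I * ((lam * gammaB ε A X.1 YZ.1.1 YZ.2.1 : ℝ) : ℂ))) •
    ((fourierSymp f YZ.1).comp (fourierSymp g YZ.2))

namespace MW
open FourierTransform Function

section PFT
set_option linter.unusedSectionVars false

/-- A splitting of `E` into the direct sum of (the range of) `ρ` and a copy of `W`. -/
structure Spl (E W : Type) [NormedAddCommGroup E] [NormedSpace ℝ E]
    [NormedAddCommGroup W] [NormedSpace ℝ W] where
  ρ : E →L[ℝ] E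
  ι : W →L[ℝ] E
  pr : E →L[ℝ] W
  ρι : ∀ w, ρ (ι w) = 0
  prι : ∀ w, pr (ι w) = w
  prρ : ∀ p, pr (ρ p) = 0
  dec : ∀ p, ρ p + ι (pr p) = p

variable {E W : Type} [NormedAddCommGroup E] [NormedSpace ℝ E]
  [NormedAddCommGroup W] [InnerProductSpace ℝ W] [FiniteDimensional ℝ W]
  [MeasurableSpace W] [BorelSpace W] (S : Spl E W)

theorem Spl.ρρ (p : E) : S.ρ (S.ρ p) = S.ρ p := by
  have h := S.dec (S.ρ p)
  rwa [S.prρ, map_zero, add_zero] at h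

theorem Spl.pr_pt (p : E) (w : W) : S.pr (S.ρ p + S.ι w) = w := by
  rw [map_add, S.prρ, S.prι, zero_add]

theorem Spl.ρ_pt (p : E) (w : W) : S.ρ (S.ρ p + S.ι w) = S.ρ p := by
  rw [map_add, S.ρρ, S.ρι, add_zero]

/-- Partial Fourier transform in the second variable. -/
def pft {F : Type*} [NormedAddCommGroup F] [NormedSpace ℂ F] (Q : E → F) (p : E) : F :=
  𝓕 (fun w => Q (S.ρ p + S.ι w)) (S.pr p)

theorem slice_tg (x : E) : (fun w : W => S.ρ x + S.ι w).HasTemperateGrowth :=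
  (Function.HasTemperateGrowth.const _).add (ContinuousLinearMap.hasTemperateGrowth _)

theorem pr_le (x : E) (w : W) : ‖w‖ ≤ ‖S.pr‖ * ‖S.ρ x + S.ι w‖ := by
  conv_lhs => rw [← S.pr_pt x w]
  exact S.pr.le_opNorm _

theorem ρ_le (x : E) (w : W) : ‖S.ρ x‖ ≤ ‖S.ρ‖ * ‖S.ρ x + S.ι w‖ := by
  conv_lhs => rw [← S.ρ_pt x w]
  exact S.ρ.le_opNorm _

/-- Slices of Schwartz functions. -/
def slice {F : Type*} [NormedAddCommGroup F] [NormedSpace ℂ F] (x : E) :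
    𝓢(E, F) →L[ℂ] 𝓢(W, F) :=
  SchwartzMap.compCLM ℂ (slice_tg S x) ⟨1, ‖S.pr‖, fun w => by
    refine (pr_le S x w).trans ?_
    rw [pow_one]
    gcongr
    linarith⟩

theorem slice_apply {F : Type*} [NormedAddCommGroup F] [NormedSpace ℂ F] (x : E)
    (Q : 𝓢(E, F)) (w : W) : slice S x Q w = Q (S.ρ x + S.ι w) := rfl

theorem pft_eq_slice {F : Type*} [NormedAddCommGroup F] [NormedSpace ℂ F]
    (Q : 𝓢(E, F)) (p : E) : pft S Q p = 𝓕 (slice S p Q) (S.pr p) := rfl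

theorem pft_eq {F : Type*} [NormedAddCommGroup F] [NormedSpace ℂ F]
    (Q : E → F) (p : E) :
    pft S Q p = ∫ w, 𝐞 (-(inner ℝ w (S.pr p))) • Q (S.ρ p + S.ι w) := rfl

theorem cont_seminorm_sup {F : Type*} [NormedAddCommGroup F] [NormedSpace ℂ F]
    (s : Finset (ℕ × ℕ)) : Continuous (⇑(s.sup (schwartzSeminormFamily ℂ E F) : Seminorm ℂ 𝓢(E, F))) := by
  classical
  induction s using Finset.induction_on with
  | empty =>
    rw [Finset.sup_empty, Seminorm.coe_bot]
    exact continuous_const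
  | insert a s _ ih =>
    rw [Finset.sup_insert, Seminorm.coe_sup]
    exact ((schwartz_withSeminorms ℂ E F).continuous_seminorm a).max ih

theorem slice_decay {F : Type*} [NormedAddCommGroup F] [NormedSpace ℂ F] (k N : ℕ) :
    ∃ q : Seminorm ℂ 𝓢(E, F), Continuous q ∧ ∀ (Q : 𝓢(E, F)) (x : E) (w : W),
      (1 + ‖S.ρ x‖) ^ k * ‖Q (S.ρ x + S.ι w)‖ ≤ q Q * (1 + ‖w‖) ^ (-(N : ℝ)) := by
  refine ⟨((1 + ‖S.ρ‖₊) ^ k * (1 + ‖S.pr‖₊) ^ N * 2 ^ (k + N) : ℝ≥0) •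
    (Finset.Iic ((k + N, 0) : ℕ × ℕ)).sup (schwartzSeminormFamily ℂ E F), ?_, ?_⟩
  · exact Continuous.const_smul (cont_seminorm_sup _)
      ((1 + ‖S.ρ‖₊) ^ k * (1 + ‖S.pr‖₊) ^ N * 2 ^ (k + N) : ℝ≥0)
  · intro Q x w
    have h := SchwartzMap.one_add_le_sup_seminorm_apply (𝕜 := ℂ) (m := (k + N, 0)) (k := k + N)
      (n := 0) le_rfl le_rfl Q (S.ρ x + S.ι w)
    set u := S.ρ x + S.ι w with hu
    have hx : 1 + ‖S.ρ x‖ ≤ (1 + ‖S.ρ‖) * (1 + ‖u‖) := by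
      nlinarith [ρ_le S x w, norm_nonneg S.ρ, norm_nonneg u]
    have hw : 1 + ‖w‖ ≤ (1 + ‖S.pr‖) * (1 + ‖u‖) := by
      nlinarith [pr_le S x w, norm_nonneg S.pr, norm_nonneg u]
    rw [Real.rpow_neg (by positivity), Real.rpow_natCast, ← div_eq_mul_inv,
      le_div_iff₀ (by positivity)]
    rw [norm_iteratedFDeriv_zero, pow_add] at h
    calc (1 + ‖S.ρ x‖) ^ k * ‖Q u‖ * (1 + ‖w‖) ^ N
        ≤ ((1 + ‖S.ρ‖) * (1 + ‖u‖)) ^ k * ‖Q u‖ * ((1 + ‖S.pr‖) * (1 + ‖u‖)) ^ N := by gcongr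
      _ = ((1 + ‖S.ρ‖) ^ k * (1 + ‖S.pr‖) ^ N) *
          ((1 + ‖u‖) ^ k * (1 + ‖u‖) ^ N * ‖Q u‖) := by rw [mul_pow, mul_pow]; ring
      _ ≤ ((1 + ‖S.ρ‖) ^ k * (1 + ‖S.pr‖) ^ N) * (2 ^ (k + N) *
          (Finset.Iic ((k + N, 0) : ℕ × ℕ)).sup (fun m => SchwartzMap.seminorm ℂ m.1 m.2) Q) :=
        mul_le_mul_of_nonneg_left h (by positivity)
      _ = _ := by
        rw [← mul_assoc]
        rfl

theorem pft_base {F : Type*} [NormedAddCommGroup F] [NormedSpace ℂ F] (k : ℕ) :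
    ∃ q : Seminorm ℂ 𝓢(E, F), Continuous q ∧ ∀ (Q : 𝓢(E, F)) (p : E),
      ‖S.ρ p‖ ^ k * ‖pft S Q p‖ ≤ q Q := by
  obtain ⟨q, hq, h⟩ := slice_decay S (F := F) k (volume : Measure W).integrablePower
  have hI := (volume : Measure W).integrable_pow_neg_integrablePower
  set I : ℝ := ∫ w : W, (1 + ‖w‖) ^ (-((volume : Measure W).integrablePower : ℝ)) with hIdef
  have hI0 : 0 ≤ I := by positivity
  refine ⟨I.toNNReal • q, hq.const_smul I.toNNReal, fun Q p => ?_⟩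
  have e : ‖S.ρ p‖ ^ k * ‖pft S Q p‖ ≤ ∫ w, ‖S.ρ p‖ ^ k * ‖Q (S.ρ p + S.ι w)‖ := by
    rw [integral_const_mul]
    gcongr
    rw [pft_eq]
    refine (norm_integral_le_integral_norm _).trans (le_of_eq ?_)
    simp
  refine e.trans ?_
  have : ∫ w, ‖S.ρ p‖ ^ k * ‖Q (S.ρ p + S.ι w)‖ ≤
      ∫ w : W, q Q * (1 + ‖w‖) ^ (-((volume : Measure W).integrablePower : ℝ)) := by
    apply integral_mono_of_nonneg
    · filter_upwards with w; positivity
    · exact hI.const_mul _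
    · filter_upwards with w
      refine le_trans ?_ (h Q p w)
      gcongr
      linarith
  refine this.trans (le_of_eq ?_)
  rw [integral_const_mul, mul_comm, ← hIdef]
  conv_lhs => rw [← Real.coe_toNNReal I hI0]
  rfl

/-- derivative in the second variable -/
def dW (F : Type*) [NormedAddCommGroup F] [NormedSpace ℂ F] :
    𝓢(E, F) →L[ℂ] 𝓢(E, W →L[ℝ] F) :=
  (SchwartzMap.postcompCLM (𝕜 := ℂ)
    { toFun := fun (T : E →L[ℝ] F) => T.comp S.ι
      map_add' := fun _ _ => rfl
      map_smul' := fun _ _ => rfl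
      cont := ((ContinuousLinearMap.compL ℝ W E F).flip S.ι).continuous }).comp
        (SchwartzMap.fderivCLM ℂ E F)

theorem dW_apply {F : Type*} [NormedAddCommGroup F] [NormedSpace ℂ F] (Q : 𝓢(E, F))
    (p : E) : dW S F Q p = (fderiv ℝ Q p).comp S.ι := rfl

/-- derivative in the first variable, extended by zero -/
def dV (F : Type*) [NormedAddCommGroup F] [NormedSpace ℂ F] :
    𝓢(E, F) →L[ℂ] 𝓢(E, E →L[ℝ] F) :=
  (SchwartzMap.postcompCLM (𝕜 := ℂ)
    { toFun := fun (T : E →L[ℝ] F) => T.comp S.ρ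
      map_add' := fun _ _ => rfl
      map_smul' := fun _ _ => rfl
      cont := ((ContinuousLinearMap.compL ℝ E E F).flip S.ρ).continuous }).comp
        (SchwartzMap.fderivCLM ℂ E F)

theorem dV_apply {F : Type*} [NormedAddCommGroup F] [NormedSpace ℂ F] (Q : 𝓢(E, F))
    (p : E) : dV S F Q p = (fderiv ℝ Q p).comp S.ρ := rfl

/-- the bilinear pairing of the second components -/
def sndInner : E →L[ℝ] E →L[ℝ] ℝ :=
  ((ContinuousLinearMap.compL ℝ E W ℝ).flip S.pr).comp ((innerSL ℝ).comp S.pr)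

theorem sndInner_apply (p r : E) : sndInner S p r = inner ℝ (S.pr p) (S.pr r) := rfl

/-- total derivative on the integrand side -/
def dT (F : Type*) [NormedAddCommGroup F] [NormedSpace ℂ F] :
    𝓢(E, F) →L[ℂ] 𝓢(E, E →L[ℝ] F) :=
  dV S F - (2 * π * Complex.I) • smulRightCLM ℂ F (sndInner S)

theorem dT_apply {F : Type*} [NormedAddCommGroup F] [NormedSpace ℂ F] (Q : 𝓢(E, F))
    (p : E) : dT S F Q p =
      dV S F Q p - (2 * π * Complex.I) • (sndInner S p).smulRight (Q p) := rfl

theorem pft_dW {F : Type*} [NormedAddCommGroup F] [NormedSpace ℂ F] (Q : 𝓢(E, F))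
    (p : E) : ‖S.pr p‖ * ‖pft S Q p‖ ≤ ‖pft S (dW S F Q) p‖ := by
  have h0 : slice S p (dW S F Q) = fderivCLM ℂ W F (slice S p Q) := by
    ext1 w
    rw [slice_apply, dW_apply, fderivCLM_apply]
    symm
    have : HasFDerivAt (fun w : W => S.ρ p + S.ι w) S.ι w :=
      S.ι.hasFDerivAt.const_add _
    exact ((Q.hasFDerivAt (S.ρ p + S.ι w)).comp w this).fderiv
  have h : pft S (dW S F Q) p =
      (2 * π * Complex.I) • ((innerSL ℝ (S.pr p)).smulRight (pft S Q p)) := by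
    rw [pft_eq_slice, h0, fourier_fderivCLM_eq]
    rfl
  rw [h, norm_smul, ContinuousLinearMap.norm_smulRight_apply, innerSL_apply_norm]
  have : (1:ℝ) ≤ ‖(2 * π * Complex.I : ℂ)‖ := by
    simp [abs_of_pos Real.pi_pos]
    linarith [Real.pi_gt_three]
  nlinarith [mul_nonneg (norm_nonneg (S.pr p)) (norm_nonneg (pft S Q p))]

theorem pft_decay {F : Type*} [NormedAddCommGroup F] [NormedSpace ℂ F] (k j : ℕ) :
    ∃ q : Seminorm ℂ 𝓢(E, F), Continuous q ∧ ∀ (Q : 𝓢(E, F)) (p : E),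
      ‖S.ρ p‖ ^ k * (‖S.pr p‖ ^ j * ‖pft S Q p‖) ≤ q Q := by
  induction j generalizing F with
  | zero => simpa using pft_base S (F := F) k
  | succ j ih =>
    obtain ⟨q, hq, h⟩ := ih (F := W →L[ℝ] F)
    refine ⟨q.comp (dW S F).toLinearMap, hq.comp (dW S F).continuous, fun Q p => ?_⟩
    refine le_trans ?_ (h (dW S F Q) p)
    rw [pow_succ, mul_assoc]
    gcongr
    exact pft_dW S Q p

theorem hasFDerivAt_pft {F : Type*} [NormedAddCommGroup F] [NormedSpace ℂ F] (Q : 𝓢(E, F))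
    (p : E) : HasFDerivAt (pft S Q) (pft S (dT S F Q) p) p := by
  obtain ⟨q, hq, h⟩ := slice_decay S (F := E →L[ℝ] F) 0
    (volume : Measure W).integrablePower
  have hI := (volume : Measure W).integrable_pow_neg_integrablePower
  have hch : ∀ p : E, Continuous fun w : W => 𝐞 (-(inner ℝ w (S.pr p))) := fun p =>
    Real.continuous_fourierChar.comp (by fun_prop)
  have hpt : ∀ p : E, Continuous fun w : W => S.ρ p + S.ι w := fun p => by fun_prop
  have key := hasFDerivAt_integral_of_dominated_of_fderiv_le (𝕜 := ℝ) (μ := (volume : Measure W))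
    (F := fun (p : E) (w : W) => 𝐞 (-(inner ℝ w (S.pr p))) • Q (S.ρ p + S.ι w))
    (F' := fun (p : E) (w : W) => 𝐞 (-(inner ℝ w (S.pr p))) • dT S F Q (S.ρ p + S.ι w))
    (bound := fun w => q (dT S F Q) * (1 + ‖w‖) ^ (-((volume : Measure W).integrablePower : ℝ)))
    (s := Set.univ) (x₀ := p) Filter.univ_mem
    (Filter.Eventually.of_forall fun p =>
      ((hch p).smul (Q.continuous.comp (hpt p))).aestronglyMeasurable)
    ?_ ((hch p).smul ((dT S F Q).continuous.comp (hpt p))).aestronglyMeasurable ?_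
    (hI.const_mul _) ?_
  · exact key
  · have := (Real.fourierIntegral_convergent_iff (f := slice S p Q) (V := W) (μ := volume)
      (S.pr p)).2 (slice S p Q).integrable
    exact this
  · filter_upwards with w p _
    have := h (dT S F Q) p w
    have e : ‖𝐞 (-(inner ℝ w (S.pr p))) • dT S F Q (S.ρ p + S.ι w)‖ =
        ‖dT S F Q (S.ρ p + S.ι w)‖ := by
      rw [Circle.smul_def]
      exact (norm_smul _ _).trans (by rw [Circle.norm_coe, one_mul])
    refine e.le.trans ?_
    simpa only [pow_zero, one_mul] using this
  · filter_upwards with w p _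
    have h1 : HasFDerivAt (fun p : E => Q (S.ρ p + S.ι w)) (dV S F Q (S.ρ p + S.ι w)) p := by
      have h3 : HasFDerivAt (fun v : E => S.ρ v + S.ι w) S.ρ p := S.ρ.hasFDerivAt.add_const _
      exact (Q.hasFDerivAt (S.ρ p + S.ι w)).comp p h3
    have h2 := (Real.hasFDerivAt_fourierChar_neg_bilinear_right (innerSL ℝ (E := W)) w
      (S.pr p)).comp p S.pr.hasFDerivAt
    have h3 := h2.smul h1
    refine h3.congr_fderiv ?_
    ext1 r
    rw [dT_apply]
    simp [sndInner_apply, S.prρ, S.prι, Circle.smul_def, smul_sub, mul_smul, sub_eq_add_neg]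
    simp only [← smul_assoc, smul_eq_mul, Complex.real_smul]
    congr 1
    push_cast
    ring_nf
    rfl

theorem differentiable_pft {F : Type*} [NormedAddCommGroup F] [NormedSpace ℂ F] (Q : 𝓢(E, F)) :
    Differentiable ℝ (pft S Q) := fun p => (hasFDerivAt_pft S Q p).differentiableAt

theorem fderiv_pft {F : Type*} [NormedAddCommGroup F] [NormedSpace ℂ F] (Q : 𝓢(E, F)) :
    fderiv ℝ (pft S Q) = pft S (dT S F Q) := funext fun p => (hasFDerivAt_pft S Q p).fderiv

theorem contDiff_pft_nat {F : Type*} [NormedAddCommGroup F] [NormedSpace ℂ F] (n : ℕ)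
    (Q : 𝓢(E, F)) : ContDiff ℝ n (pft S Q) := by
  induction n generalizing F with
  | zero => exact contDiff_zero.2 (differentiable_pft S Q).continuous
  | succ n ih =>
    push_cast
    rw [contDiff_succ_iff_fderiv]
    refine ⟨differentiable_pft S Q, by simp, ?_⟩
    rw [fderiv_pft]
    exact ih _

theorem pft_bound {F : Type*} [NormedAddCommGroup F] [NormedSpace ℂ F] (n k : ℕ) :
    ∃ q : Seminorm ℂ 𝓢(E, F), Continuous q ∧ ∀ (Q : 𝓢(E, F)) (p : E),
      ‖p‖ ^ k * ‖iteratedFDeriv ℝ n (pft S Q) p‖ ≤ q Q := by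
  induction n generalizing F with
  | zero =>
    obtain ⟨q1, hq1, h1⟩ := pft_decay S (F := F) k 0
    obtain ⟨q2, hq2, h2⟩ := pft_decay S (F := F) 0 k
    refine ⟨(2 ^ (k - 1) : ℝ≥0) • (q1 + (‖S.ι‖₊ ^ k) • q2),
      (hq1.add (hq2.const_smul (‖S.ι‖₊ ^ k))).const_smul (2 ^ (k - 1) : ℝ≥0), fun Q p => ?_⟩
    rw [norm_iteratedFDeriv_zero]
    have e1 := h1 Q p
    have e2 := h2 Q p
    simp only [pow_zero, one_mul] at e1 e2
    have hp : ‖p‖ ≤ ‖S.ρ p‖ + ‖S.ι‖ * ‖S.pr p‖ := by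
      conv_lhs => rw [← S.dec p]
      exact (norm_add_le _ _).trans (by gcongr; exact S.ι.le_opNorm _)
    calc ‖p‖ ^ k * ‖pft S Q p‖ ≤ (‖S.ρ p‖ + ‖S.ι‖ * ‖S.pr p‖) ^ k * ‖pft S Q p‖ := by gcongr
      _ ≤ (2 ^ (k - 1) * (‖S.ρ p‖ ^ k + (‖S.ι‖ * ‖S.pr p‖) ^ k)) * ‖pft S Q p‖ := by
        gcongr
        exact add_pow_le (by positivity) (by positivity) k
      _ = 2 ^ (k - 1) * (‖S.ρ p‖ ^ k * ‖pft S Q p‖ +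
          ‖S.ι‖ ^ k * (‖S.pr p‖ ^ k * ‖pft S Q p‖)) := by rw [mul_pow]; ring
      _ ≤ 2 ^ (k - 1) * (q1 Q + ‖S.ι‖ ^ k * q2 Q) := by gcongr
      _ = _ := rfl
  | succ n ih =>
    obtain ⟨q, hq, h⟩ := ih (F := E →L[ℝ] F)
    refine ⟨q.comp (dT S F).toLinearMap, hq.comp (dT S F).continuous, fun Q p => ?_⟩
    refine le_trans ?_ (h (dT S F Q) p)
    rw [← norm_iteratedFDeriv_fderiv, fderiv_pft]

/-- Partial Fourier transform as a continuous linear map on Schwartz space. -/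
def pftCLM (F : Type*) [NormedAddCommGroup F] [NormedSpace ℂ F] : 𝓢(E, F) →L[ℂ] 𝓢(E, F) :=
  mkCLM (fun Q => pft S Q)
    (fun f g p => by
      rw [pft_eq_slice, pft_eq_slice, pft_eq_slice, map_add, FourierTransform.fourier_add]; rfl)
    (fun a f p => by
      rw [pft_eq_slice, pft_eq_slice, map_smul, FourierTransform.fourier_smul]; rfl)
    (fun f => contDiff_infty.2 fun n => contDiff_pft_nat S n f)
    (fun n => by
      obtain ⟨q, hq, h⟩ := pft_bound S (F := F) n.2 n.1
      obtain ⟨s, C, hC, hle⟩ := Seminorm.bound_of_continuous (schwartz_withSeminorms ℂ E F) q hq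
      exact ⟨s, C, C.2, fun f x => (h f x).trans (hle f)⟩)

theorem pftCLM_apply {F : Type*} [NormedAddCommGroup F] [NormedSpace ℂ F] (Q : 𝓢(E, F))
    (p : E) : pftCLM S F Q p = ∫ w, 𝐞 (-(inner ℝ w (S.pr p))) • Q (S.ρ p + S.ι w) := rfl

end PFT
end MW

namespace MW
open FourierTransform Function

section Tensor
set_option linter.unusedSectionVars false

variable {E V₁ V₂ : Type} [NormedAddCommGroup E] [NormedSpace ℝ E]
  [NormedAddCommGroup V₁] [NormedSpace ℝ V₁] [NormedAddCommGroup V₂] [NormedSpace ℝ V₂]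

/-- A pair of linear maps that is jointly bounded below. -/
structure Pair (E V₁ V₂ : Type) [NormedAddCommGroup E] [NormedSpace ℝ E]
    [NormedAddCommGroup V₁] [NormedSpace ℝ V₁] [NormedAddCommGroup V₂] [NormedSpace ℝ V₂] where
  a : E →L[ℝ] V₁
  b : E →L[ℝ] V₂
  c : ℝ
  hc : 0 ≤ c
  le : ∀ p, ‖p‖ ≤ c * (‖a p‖ + ‖b p‖)

variable (T : Pair E V₁ V₂) {F₁ F₂ G : Type*} [NormedAddCommGroup F₁] [NormedSpace ℂ F₁]
  [NormedAddCommGroup F₂] [NormedSpace ℂ F₂] [NormedAddCommGroup G] [NormedSpace ℂ G]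
  (L : F₁ →L[ℂ] F₂ →L[ℂ] G)

theorem iter_comp_le {V F : Type*} [NormedAddCommGroup V] [NormedSpace ℝ V]
    [NormedAddCommGroup F] [NormedSpace ℝ F] (a : E →L[ℝ] V) (f : 𝓢(V, F)) (n : ℕ) (p : E) :
    ‖iteratedFDeriv ℝ n (fun p => f (a p)) p‖ ≤ ‖a‖ ^ n * ‖iteratedFDeriv ℝ n f (a p)‖ := by
  have h := a.iteratedFDeriv_comp_right (f := f) (f.smooth ⊤) p (i := n) (by exact_mod_cast le_top)
  have h' : iteratedFDeriv ℝ n (fun p => f (a p)) p =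
      (iteratedFDeriv ℝ n f (a p)).compContinuousLinearMap fun _ => a := h
  rw [h', mul_comm]
  refine (ContinuousMultilinearMap.norm_compContinuousLinearMap_le _ _).trans ?_
  simp

/-- the seminorm controlling derivatives up to order `n` with weight `k` -/
def sn (k n : ℕ) (V F : Type*) [NormedAddCommGroup V] [NormedSpace ℝ V]
    [NormedAddCommGroup F] [NormedSpace ℂ F] : Seminorm ℂ 𝓢(V, F) :=
  (Finset.Iic ((k, n) : ℕ × ℕ)).sup (schwartzSeminormFamily ℂ V F)

theorem sn_le {V F : Type*} [NormedAddCommGroup V] [NormedSpace ℝ V]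
    [NormedAddCommGroup F] [NormedSpace ℂ F] (k n i : ℕ) (hi : i ≤ n) (f : 𝓢(V, F)) (v : V) :
    (1 + ‖v‖) ^ k * ‖iteratedFDeriv ℝ i f v‖ ≤ 2 ^ k * sn k n V F f :=
  SchwartzMap.one_add_le_sup_seminorm_apply (𝕜 := ℂ) (m := (k, n)) le_rfl hi f v

theorem tens_contDiff (f : 𝓢(V₁, F₁)) (g : 𝓢(V₂, F₂)) :
    ContDiff ℝ (⊤ : ℕ∞) (fun p : E => L (f (T.a p)) (g (T.b p))) :=
  (L.bilinearRestrictScalars ℝ).isBoundedBilinearMap.contDiff.comp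
    (((f.smooth ⊤).comp T.a.contDiff).prodMk ((g.smooth ⊤).comp T.b.contDiff))

theorem tens_bound (k n : ℕ) : ∃ C : ℝ, 0 ≤ C ∧ ∀ (f : 𝓢(V₁, F₁)) (g : 𝓢(V₂, F₂)) (p : E),
    ‖p‖ ^ k * ‖iteratedFDeriv ℝ n (fun p : E => L (f (T.a p)) (g (T.b p))) p‖ ≤
      C * (sn k n V₁ F₁ f * sn k n V₂ F₂ g) := by
  refine ⟨T.c ^ k * (‖L.bilinearRestrictScalars ℝ‖ * ∑ i ∈ Finset.range (n + 1),
    (n.choose i : ℝ) * (‖T.a‖ ^ i * 2 ^ k) * (‖T.b‖ ^ (n - i) * 2 ^ k)), ?_, ?_⟩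
  · have := T.hc
    positivity
  intro f g p
  have h := (L.bilinearRestrictScalars ℝ).norm_iteratedFDeriv_le_of_bilinear
    (f := fun p : E => f (T.a p)) (g := fun p : E => g (T.b p)) (N := (⊤ : ℕ∞))
    ((f.smooth ⊤).comp T.a.contDiff) ((g.smooth ⊤).comp T.b.contDiff) p (n := n)
    (by exact_mod_cast le_top)
  have hp : ‖p‖ ≤ T.c * ((1 + ‖T.a p‖) * (1 + ‖T.b p‖)) := by
    refine (T.le p).trans (mul_le_mul_of_nonneg_left ?_ T.hc)
    nlinarith [norm_nonneg (T.a p), norm_nonneg (T.b p)]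
  have hc := T.hc
  calc ‖p‖ ^ k * ‖iteratedFDeriv ℝ n (fun p : E => L (f (T.a p)) (g (T.b p))) p‖
      ≤ (T.c * ((1 + ‖T.a p‖) * (1 + ‖T.b p‖))) ^ k * (‖L.bilinearRestrictScalars ℝ‖ *
        ∑ i ∈ Finset.range (n + 1), (n.choose i : ℝ) *
          ‖iteratedFDeriv ℝ i (fun p : E => f (T.a p)) p‖ *
          ‖iteratedFDeriv ℝ (n - i) (fun p : E => g (T.b p)) p‖) := by
        gcongr
        exact h
    _ ≤ (T.c * ((1 + ‖T.a p‖) * (1 + ‖T.b p‖))) ^ k * (‖L.bilinearRestrictScalars ℝ‖ *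
        ∑ i ∈ Finset.range (n + 1), (n.choose i : ℝ) *
          (‖T.a‖ ^ i * ‖iteratedFDeriv ℝ i f (T.a p)‖) *
          (‖T.b‖ ^ (n - i) * ‖iteratedFDeriv ℝ (n - i) g (T.b p)‖)) := by
        gcongr
        · exact iter_comp_le _ _ _ _
        · exact iter_comp_le _ _ _ _
    _ = T.c ^ k * (‖L.bilinearRestrictScalars ℝ‖ * ∑ i ∈ Finset.range (n + 1),
          (n.choose i : ℝ) * (‖T.a‖ ^ i * ((1 + ‖T.a p‖) ^ k * ‖iteratedFDeriv ℝ i f (T.a p)‖)) *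
          (‖T.b‖ ^ (n - i) * ((1 + ‖T.b p‖) ^ k * ‖iteratedFDeriv ℝ (n - i) g (T.b p)‖))) := by
        rw [mul_pow, mul_pow]
        simp only [Finset.mul_sum]
        refine Finset.sum_congr rfl fun i _ => ?_
        ring
    _ ≤ T.c ^ k * (‖L.bilinearRestrictScalars ℝ‖ * ∑ i ∈ Finset.range (n + 1),
          (n.choose i : ℝ) * (‖T.a‖ ^ i * (2 ^ k * sn k n V₁ F₁ f)) *
          (‖T.b‖ ^ (n - i) * (2 ^ k * sn k n V₂ F₂ g))) := by
        have e : ∀ i ∈ Finset.range (n + 1),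
            (n.choose i : ℝ) * (‖T.a‖ ^ i * ((1 + ‖T.a p‖) ^ k * ‖iteratedFDeriv ℝ i f (T.a p)‖)) *
            (‖T.b‖ ^ (n - i) * ((1 + ‖T.b p‖) ^ k * ‖iteratedFDeriv ℝ (n - i) g (T.b p)‖)) ≤
            (n.choose i : ℝ) * (‖T.a‖ ^ i * (2 ^ k * sn k n V₁ F₁ f)) *
            (‖T.b‖ ^ (n - i) * (2 ^ k * sn k n V₂ F₂ g)) := by
          intro i hi
          have h1 := sn_le k n i (by simp at hi; omega) f (T.a p)
          have h2 := sn_le k n (n - i) (by omega) g (T.b p)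
          generalize (1 + ‖T.a p‖) ^ k * ‖iteratedFDeriv ℝ i f (T.a p)‖ = X at *
          have h0 : 0 ≤ (1 + ‖T.b p‖) ^ k * ‖iteratedFDeriv ℝ (n - i) g (T.b p)‖ := by positivity
          generalize (1 + ‖T.b p‖) ^ k * ‖iteratedFDeriv ℝ (n - i) g (T.b p)‖ = Y at *
          gcongr
        gcongr T.c ^ k * (_ * ?_)
        exact Finset.sum_le_sum e
    _ = _ := by
        rw [mul_assoc, mul_assoc]
        simp only [Finset.mul_sum, Finset.sum_mul]
        refine Finset.sum_congr rfl fun i _ => ?_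
        ring

/-- tensor product pulled back, for fixed first factor -/
def tens₁ (f : 𝓢(V₁, F₁)) : 𝓢(V₂, F₂) →L[ℂ] 𝓢(E, G) :=
  mkCLM (fun g p => L (f (T.a p)) (g (T.b p))) (fun _ _ _ => by simp) (fun _ _ _ => by simp)
    (fun g => tens_contDiff T L f g)
    (fun n => by
      obtain ⟨C, hC, h⟩ := tens_bound T L (F₁ := F₁) (F₂ := F₂) n.1 n.2
      refine ⟨Finset.Iic (n.1, n.2), C * sn n.1 n.2 V₁ F₁ f, by positivity, fun g p => ?_⟩
      refine (h f g p).trans (le_of_eq ?_)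
      rw [mul_assoc]
      rfl)

theorem tens₁_apply (f : 𝓢(V₁, F₁)) (g : 𝓢(V₂, F₂)) (p : E) :
    tens₁ T L f g p = L (f (T.a p)) (g (T.b p)) := rfl

/-- tensor product pulled back, as a linear map -/
def tensL : 𝓢(V₁, F₁) →ₗ[ℂ] 𝓢(V₂, F₂) →L[ℂ] 𝓢(E, G) where
  toFun f := tens₁ T L f
  map_add' f f' := by ext g p; simp [tens₁_apply]
  map_smul' c f := by ext g p; simp [tens₁_apply]

theorem tensL_apply (f : 𝓢(V₁, F₁)) (g : 𝓢(V₂, F₂)) (p : E) :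
    tensL T L f g p = L (f (T.a p)) (g (T.b p)) := rfl

theorem tens_seminorm (k n : ℕ) : ∃ C : ℝ, 0 ≤ C ∧ ∀ (f : 𝓢(V₁, F₁)) (g : 𝓢(V₂, F₂)),
    SchwartzMap.seminorm ℂ k n (tensL T L f g) ≤ C * (sn k n V₁ F₁ f * sn k n V₂ F₂ g) := by
  obtain ⟨C, hC, h⟩ := tens_bound T L (F₁ := F₁) (F₂ := F₂) k n
  exact ⟨C, hC, fun f g => SchwartzMap.seminorm_le_bound ℂ k n _ (by positivity) (h f g)⟩

theorem continuous_sn (k n : ℕ) {V : Type} {F : Type*} [NormedAddCommGroup V] [NormedSpace ℝ V]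
    [NormedAddCommGroup F] [NormedSpace ℂ F] : Continuous (sn k n V F) :=
  cont_seminorm_sup _

theorem tensL_jcont :
    Continuous (fun p : 𝓢(V₁, F₁) × 𝓢(V₂, F₂) => tensL (E := E) T L p.1 p.2) := by
  rw [continuous_iff_continuousAt]
  rintro ⟨f₀, g₀⟩
  rw [ContinuousAt, (schwartz_withSeminorms ℂ E G).tendsto_nhds]
  rintro ⟨k, n⟩ δ hδ
  obtain ⟨C, hC, h⟩ := tens_seminorm (E := E) T L (F₁ := F₁) (F₂ := F₂) k n
  have hlim : Filter.Tendsto (fun p : 𝓢(V₁, F₁) × 𝓢(V₂, F₂) =>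
      C * (sn k n V₁ F₁ (p.1 - f₀) * sn k n V₂ F₂ p.2) +
      C * (sn k n V₁ F₁ f₀ * sn k n V₂ F₂ (p.2 - g₀))) (nhds (f₀, g₀)) (nhds 0) := by
    have hc : Continuous (fun p : 𝓢(V₁, F₁) × 𝓢(V₂, F₂) =>
      C * (sn k n V₁ F₁ (p.1 - f₀) * sn k n V₂ F₂ p.2) +
      C * (sn k n V₁ F₁ f₀ * sn k n V₂ F₂ (p.2 - g₀))) := by
      have h1 := (continuous_sn k n (V := V₁) (F := F₁)).comp
        (continuous_fst.sub continuous_const : Continuous fun p : 𝓢(V₁, F₁) × 𝓢(V₂, F₂) =>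
          p.1 - f₀)
      have h2 := (continuous_sn k n (V := V₂) (F := F₂)).comp
        (continuous_snd : Continuous fun p : 𝓢(V₁, F₁) × 𝓢(V₂, F₂) => p.2)
      have h3 := (continuous_sn k n (V := V₂) (F := F₂)).comp
        (continuous_snd.sub continuous_const : Continuous fun p : 𝓢(V₁, F₁) × 𝓢(V₂, F₂) =>
          p.2 - g₀)
      exact (continuous_const.mul (h1.mul h2)).add (continuous_const.mul (continuous_const.mul h3))
    have := hc.tendsto (f₀, g₀)
    simpa using this
  filter_upwards [hlim.eventually (gt_mem_nhds hδ)] with p hp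
  refine lt_of_le_of_lt ?_ hp
  have e : tensL (E := E) T L p.1 p.2 - tensL T L f₀ g₀ =
      tensL T L (p.1 - f₀) p.2 + tensL T L f₀ (p.2 - g₀) := by
    ext x
    simp [tensL_apply]
  change SchwartzMap.seminorm ℂ k n (tensL (E := E) T L p.1 p.2 - tensL T L f₀ g₀) ≤ _
  rw [e]
  exact (map_add_le_add _ _ _).trans (add_le_add (h _ _) (h _ _))

/-- tensor product pulled back, as a continuous bilinear map -/
def tens : 𝓢(V₁, F₁) →L[ℂ] 𝓢(V₂, F₂) →L[ℂ] 𝓢(E, G) :=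
  ⟨tensL T L, ContinuousLinearMap.continuous_of_continuous_uncurry _ (tensL_jcont T L)⟩

theorem tens_apply (f : 𝓢(V₁, F₁)) (g : 𝓢(V₂, F₂)) (p : E) :
    tens T L f g p = L (f (T.a p)) (g (T.b p)) := rfl

end Tensor
end MW

namespace MW
open FourierTransform Function

section Stokes

theorem triangle_swap (g : ℝ → ℝ → ℝ) (hg : Continuous (uncurry g)) :
    ∫ s in (0:ℝ)..1, ∫ t in (0:ℝ)..(1 - s), g s t = ∫ t in (0:ℝ)..1, ∫ s in (0:ℝ)..(1 - t), g s t := by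
  have key : ∀ (h : ℝ → ℝ → ℝ), ∫ s in (0:ℝ)..1, ∫ t in (0:ℝ)..(1 - s), h s t =
      ∫ s in Set.Ioc (0:ℝ) 1, ∫ t in Set.Ioc (0:ℝ) 1,
        (if s + t ≤ 1 then h s t else 0) := by
    intro h
    rw [intervalIntegral.integral_of_le zero_le_one]
    refine setIntegral_congr_fun measurableSet_Ioc fun s hs => ?_
    have hs' : 0 ≤ 1 - s := by linarith [hs.2]
    change (∫ t in (0:ℝ)..(1 - s), h s t) = ∫ t in Set.Ioc (0:ℝ) 1, (if s + t ≤ 1 then h s t else 0)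
    rw [intervalIntegral.integral_of_le hs']
    have e : (fun t => if s + t ≤ 1 then h s t else 0) =
        (Set.Iic (1 - s)).indicator (fun t => h s t) := by
      ext t
      simp only [Set.indicator, Set.mem_Iic, le_sub_iff_add_le, add_comm]
    rw [e, setIntegral_indicator measurableSet_Iic]
    congr 2
    ext t
    simp only [Set.mem_Ioc, Set.mem_inter_iff, Set.mem_Iic]
    constructor
    · intro ht; exact ⟨⟨ht.1, by linarith [hs.1, ht.2]⟩, ht.2⟩
    · intro ht; exact ⟨ht.1.1, ht.2⟩
  rw [key, key (fun t s => g s t)]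
  rw [integral_integral_swap]
  · simp only [add_comm]
  · rw [Measure.prod_restrict]
    have hS : MeasurableSet {p : ℝ × ℝ | p.1 + p.2 ≤ 1} :=
      measurableSet_le (by fun_prop) (by fun_prop)
    have e : (uncurry fun s t : ℝ => if s + t ≤ 1 then g s t else 0) =
        {p : ℝ × ℝ | p.1 + p.2 ≤ 1}.indicator (uncurry g) := by
      ext ⟨s, t⟩
      simp [Set.indicator, uncurry]
    rw [e]
    refine Integrable.indicator ?_ hS
    have : IntegrableOn (uncurry g) (Set.Icc (0:ℝ) 1 ×ˢ Set.Icc (0:ℝ) 1) (volume.prod volume) :=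
      hg.continuousOn.integrableOn_compact (isCompact_Icc.prod isCompact_Icc)
    exact this.mono_set (Set.prod_mono Set.Ioc_subset_Icc_self Set.Ioc_subset_Icc_self)

variable {d : ℕ}

theorem bcomp_sum (A : Ed d → Ed d) (hA : Differentiable ℝ A) (x u v : Ed d) :
    ∑ j : Fin d, ∑ l : Fin d, Bcomp A x j l * u j * v l =
      inner ℝ (fderiv ℝ A x u) v - inner ℝ (fderiv ℝ A x v) u := by
  have hc : ∀ (l : Fin d) (w : Ed d), fderiv ℝ (fun z => A z l) x w = (fderiv ℝ A x w) l := by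
    intro l w
    have h := ((EuclideanSpace.proj l : Ed d →L[ℝ] ℝ).hasFDerivAt.comp x (hA x).hasFDerivAt).fderiv
    have h' : fderiv ℝ (fun z => A z l) x =
      (EuclideanSpace.proj l : Ed d →L[ℝ] ℝ).comp (fderiv ℝ A x) := h
    rw [h']
    rfl
  have hu : ∀ w : Ed d, fderiv ℝ A x w =
      ∑ j, w j • fderiv ℝ A x (EuclideanSpace.single j (1:ℝ)) := by
    intro w
    have : w = ∑ j, w j • EuclideanSpace.single j (1:ℝ) := by
      ext i
      simp [Pi.single_apply]
    conv_lhs => rw [this]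
    simp [map_sum]
  simp only [Bcomp, hc]
  rw [hu u, hu v]
  simp only [PiLp.inner_apply, sum_inner, inner_smul_left]
  simp only [sub_mul, Finset.sum_sub_distrib]
  congr 1
  · refine Finset.sum_congr rfl fun j _ => ?_
    simp [PiLp.inner_apply, Finset.mul_sum]
    refine Finset.sum_congr rfl fun l _ => ?_
    ring
  · rw [Finset.sum_comm]
    refine Finset.sum_congr rfl fun j _ => ?_
    simp [PiLp.inner_apply, Finset.mul_sum]
    refine Finset.sum_congr rfl fun l _ => ?_
    ring

theorem flux_ftc (A : Ed d → Ed d) (hA : ContDiff ℝ (⊤ : ℕ∞) A) (q v u : Ed d) (r : ℝ) :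
    ∫ t in (0:ℝ)..r, inner ℝ (fderiv ℝ A (q + t • v) v) u =
      inner ℝ (A (q + r • v)) u - inner ℝ (A q) u := by
  have hd : Differentiable ℝ A := hA.differentiable (by simp)
  have hc : Continuous (fderiv ℝ A) := hA.continuous_fderiv (by simp)
  have : ∀ t : ℝ, HasDerivAt (fun t : ℝ => inner ℝ (A (q + t • v)) u)
      (inner ℝ (fderiv ℝ A (q + t • v) v) u) t := by
    intro t
    have h1 : HasDerivAt (fun t : ℝ => q + t • v) v t := by
      simpa using ((hasDerivAt_id t).smul_const v).const_add q
    have h2 := (hd (q + t • v)).hasFDerivAt.comp_hasDerivAt t h1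
    have := h2.inner ℝ (hasDerivAt_const t u)
    simpa using this
  rw [intervalIntegral.integral_eq_sub_of_hasDerivAt (fun t _ => this t)]
  · simp
  · apply Continuous.intervalIntegrable
    have : Continuous fun t : ℝ => fderiv ℝ A (q + t • v) v :=
      (hc.comp (by fun_prop)).clm_apply continuous_const
    exact this.inner continuous_const

theorem stokes (A : Ed d → Ed d) (hA : ContDiff ℝ (⊤ : ℕ∞) A) (q₀ q₁ q₂ : Ed d) :
    fluxTriangle A q₀ q₁ q₂ = lineInt A q₀ q₁ + lineInt A q₁ q₂ - lineInt A q₀ q₂ := by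
  have hd : Differentiable ℝ A := hA.differentiable (by simp)
  have hA0 : Continuous A := hA.continuous
  have hc : Continuous (fderiv ℝ A) := hA.continuous_fderiv (by simp)
  obtain ⟨u, hu⟩ : ∃ u, u = q₁ - q₀ := ⟨_, rfl⟩
  obtain ⟨v, hv⟩ : ∃ v, v = q₂ - q₀ := ⟨_, rfl⟩
  have h12 : q₂ - q₁ = v - u := by rw [hu, hv]; abel
  have h1 : q₁ = q₀ + u := by rw [hu]; abel
  unfold fluxTriangle lineInt
  simp only [bcomp_sum A hd]
  rw [← hu, ← hv, h12]
  have c1 : Continuous (uncurry fun s t : ℝ => inner ℝ (fderiv ℝ A (q₀ + s • u + t • v) u) v) := by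
    have : Continuous fun p : ℝ × ℝ => fderiv ℝ A (q₀ + p.1 • u + p.2 • v) u :=
      (hc.comp (by fun_prop)).clm_apply continuous_const
    exact this.inner continuous_const
  have c2 : Continuous (uncurry fun s t : ℝ => inner ℝ (fderiv ℝ A (q₀ + s • u + t • v) v) u) := by
    have : Continuous fun p : ℝ × ℝ => fderiv ℝ A (q₀ + p.1 • u + p.2 • v) v :=
      (hc.comp (by fun_prop)).clm_apply continuous_const
    exact this.inner continuous_const
  have i1 : ∀ s a b : ℝ, IntervalIntegrable
      (fun t : ℝ => inner ℝ (fderiv ℝ A (q₀ + s • u + t • v) u) v) volume a b := fun s a b =>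
    (c1.comp (by fun_prop : Continuous fun t : ℝ => (s, t))).intervalIntegrable _ _
  have i2 : ∀ s a b : ℝ, IntervalIntegrable
      (fun t : ℝ => inner ℝ (fderiv ℝ A (q₀ + s • u + t • v) v) u) volume a b := fun s a b =>
    (c2.comp (by fun_prop : Continuous fun t : ℝ => (s, t))).intervalIntegrable _ _
  simp only [intervalIntegral.integral_sub (i1 _ _ _) (i2 _ _ _)]
  have cA : ∀ (f : ℝ → Ed d) (w : Ed d), Continuous f →
      Continuous fun s => (inner ℝ (A (f s)) w : ℝ) := fun f w hf =>
    (hA0.comp hf).inner continuous_const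
  have e2 : ∀ s : ℝ, ∫ t in (0:ℝ)..(1 - s), inner ℝ (fderiv ℝ A (q₀ + s • u + t • v) v) u =
      inner ℝ (A (q₀ + s • u + (1 - s) • v)) u - inner ℝ (A (q₀ + s • u)) u := fun s =>
    flux_ftc A hA _ _ _ _
  have e1 : ∀ t : ℝ, ∫ s in (0:ℝ)..(1 - t), inner ℝ (fderiv ℝ A (q₀ + s • u + t • v) u) v =
      inner ℝ (A (q₀ + (1 - t) • u + t • v)) v - inner ℝ (A (q₀ + t • v)) v := fun t => by
    have := flux_ftc A hA (q₀ + t • v) u v (1 - t)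
    simp only [add_right_comm q₀ (t • v)] at this
    exact this
  have ci1 : Continuous fun s : ℝ =>
      ∫ t in (0:ℝ)..(1 - s), inner ℝ (fderiv ℝ A (q₀ + s • u + t • v) u) v :=
    intervalIntegral.continuous_parametric_intervalIntegral_of_continuous
      (f := fun s t => inner ℝ (fderiv ℝ A (q₀ + s • u + t • v) u) v) c1 (by fun_prop)
  have ci2 : Continuous fun s : ℝ =>
      ∫ t in (0:ℝ)..(1 - s), inner ℝ (fderiv ℝ A (q₀ + s • u + t • v) v) u :=
    intervalIntegral.continuous_parametric_intervalIntegral_of_continuous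
      (f := fun s t => inner ℝ (fderiv ℝ A (q₀ + s • u + t • v) v) u) c2 (by fun_prop)
  rw [intervalIntegral.integral_sub (ci1.intervalIntegrable _ _) (ci2.intervalIntegrable _ _)]
  rw [triangle_swap (fun s t => inner ℝ (fderiv ℝ A (q₀ + s • u + t • v) u) v) c1]
  simp only [e1, e2]
  rw [intervalIntegral.integral_sub ((cA _ _ (by fun_prop)).intervalIntegrable _ _)
      ((cA _ _ (by fun_prop)).intervalIntegrable _ _),
    intervalIntegral.integral_sub ((cA _ _ (by fun_prop)).intervalIntegrable _ _)
      ((cA _ _ (by fun_prop)).intervalIntegrable _ _)]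
  have e3 : ∫ s in (0:ℝ)..1, inner ℝ (A (q₁ + s • (v - u))) (v - u) =
      (∫ s in (0:ℝ)..1, inner ℝ (A (q₀ + (1 - s) • u + s • v)) v) -
      ∫ s in (0:ℝ)..1, inner ℝ (A (q₀ + s • u + (1 - s) • v)) u := by
    have r : ∫ s in (0:ℝ)..1, inner ℝ (A (q₀ + s • u + (1 - s) • v)) u =
        ∫ s in (0:ℝ)..1, inner ℝ (A (q₀ + (1 - s) • u + s • v)) u := by
      have := intervalIntegral.integral_comp_sub_left (a := (0:ℝ)) (b := 1)
        (fun s : ℝ => (inner ℝ (A (q₀ + (1 - s) • u + s • v)) u : ℝ)) 1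
      simp only [sub_sub_cancel, sub_self, sub_zero] at this
      exact this
    rw [r, ← intervalIntegral.integral_sub ((cA _ _ (by fun_prop)).intervalIntegrable _ _)
      ((cA _ _ (by fun_prop)).intervalIntegrable _ _)]
    refine intervalIntegral.integral_congr fun s _ => ?_
    have : q₁ + s • (v - u) = q₀ + (1 - s) • u + s • v := by
      rw [h1, smul_sub, sub_smul, one_smul]; abel
    simp only [this, inner_sub_right]
  rw [e3]
  ring

end Stokes
end MW

namespace MW
open FourierTransform Function

section Temperate

theorem tg_fderiv {E F : Type*} [NormedAddCommGroup E] [NormedSpace ℝ E]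
    [NormedAddCommGroup F] [NormedSpace ℝ F] {f : E → F} (hf : f.HasTemperateGrowth) :
    (fderiv ℝ f).HasTemperateGrowth := by
  refine ⟨hf.1.fderiv_right (m := (⊤ : ℕ∞)) (by simp), fun n => ?_⟩
  obtain ⟨k, C, h⟩ := hf.2 (n + 1)
  exact ⟨k, C, fun x => by rw [norm_iteratedFDeriv_fderiv]; exact h x⟩

variable {E E' : Type} [NormedAddCommGroup E] [NormedSpace ℝ E]
  [NormedAddCommGroup E'] [NormedSpace ℝ E'] (i : E →L[ℝ] E') (j : ℝ → E')

/-- parametric integral -/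
def pint {F : Type*} [NormedAddCommGroup F] [NormedSpace ℝ F] (G : E' → F) (p : E) : F :=
  ∫ s in (0:ℝ)..1, G (j s + i p)

theorem pint_bound (hj : Continuous j) {F : Type*} [NormedAddCommGroup F] [NormedSpace ℝ F]
    (G : E' → F) (hG : G.HasTemperateGrowth) :
    ∃ (k : ℕ) (C : ℝ), 0 ≤ C ∧ ∀ p : E, ∀ s ∈ Set.Icc (0:ℝ) 1,
      ‖G (j s + i p)‖ ≤ C * (1 + ‖p‖) ^ k := by
  obtain ⟨k, C, hC, h⟩ := hG.norm_iteratedFDeriv_le_uniform 0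
  obtain ⟨M, hM⟩ := isCompact_Icc (a := (0:ℝ)) (b := 1) |>.exists_bound_of_continuousOn
    hj.continuousOn
  have hM0 : 0 ≤ M := (norm_nonneg _).trans (hM 0 (by simp))
  refine ⟨k, C * (1 + M + ‖i‖) ^ k, by positivity, fun p s hs => ?_⟩
  have h1 := h 0 le_rfl (j s + i p)
  rw [norm_iteratedFDeriv_zero] at h1
  refine h1.trans ?_
  rw [mul_assoc, ← mul_pow]
  gcongr
  have h2 : ‖j s + i p‖ ≤ M + ‖i‖ * ‖p‖ :=
    (norm_add_le _ _).trans (add_le_add (hM s hs) (i.le_opNorm p))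
  nlinarith [norm_nonneg p, norm_nonneg i]

/-- derivative along `i` -/
def dI {F : Type*} [NormedAddCommGroup F] [NormedSpace ℝ F] (G : E' → F) : E' → E →L[ℝ] F :=
  fun q => (fderiv ℝ G q).comp i

theorem dI_tg {F : Type*} [NormedAddCommGroup F] [NormedSpace ℝ F]
    {G : E' → F} (hG : G.HasTemperateGrowth) : (dI i G).HasTemperateGrowth :=
  (((ContinuousLinearMap.compL ℝ E E' F).flip i).hasTemperateGrowth).comp (tg_fderiv hG)

theorem pint_hasFDerivAt (hj : Continuous j) {F : Type*} [NormedAddCommGroup F] [NormedSpace ℝ F]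
    (G : E' → F) (hG : G.HasTemperateGrowth) (p : E) :
    HasFDerivAt (pint i j G) (pint i j (dI i G) p) p := by
  obtain ⟨k, C, hC, h⟩ := pint_bound i j hj _ (dI_tg i hG)
  have hI : Set.uIoc (0:ℝ) 1 ⊆ Set.Icc 0 1 := by
    rw [Set.uIoc_of_le zero_le_one]; exact Set.Ioc_subset_Icc_self
  have hc : ∀ p : E, Continuous fun s : ℝ => j s + i p := fun p => by fun_prop
  have hdc : Continuous (dI i G) := (dI_tg i hG).1.continuous
  refine intervalIntegral.hasFDerivAt_integral_of_dominated_of_fderiv_le (𝕜 := ℝ)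
    (F := fun p s => G (j s + i p)) (F' := fun p s => dI i G (j s + i p))
    (bound := fun _ => C * (1 + (‖p‖ + 1)) ^ k) (Metric.ball_mem_nhds p one_pos)
    (Filter.Eventually.of_forall fun p => (hG.1.continuous.comp (hc p)).aestronglyMeasurable)
    ((hG.1.continuous.comp (hc p)).intervalIntegrable _ _)
    (hdc.comp (hc p)).aestronglyMeasurable ?_ intervalIntegrable_const ?_
  · filter_upwards with s hs x hx
    refine (h x s (hI hs)).trans ?_
    gcongr
    have : ‖x‖ ≤ ‖p‖ + ‖x - p‖ := by
      have := norm_add_le p (x - p); simpa using this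
    rw [mem_ball_iff_norm] at hx
    linarith
  · filter_upwards with s hs x hx
    have h1 : HasFDerivAt (fun x : E => j s + i x) i x := i.hasFDerivAt.const_add _
    exact ((hG.1.differentiable (by simp)) (j s + i x)).hasFDerivAt.comp x h1

theorem pint_aux (hj : Continuous j) (n : ℕ) {F : Type*} [NormedAddCommGroup F] [NormedSpace ℝ F]
    (G : E' → F) (hG : G.HasTemperateGrowth) :
    ContDiff ℝ n (pint i j G) ∧ ∃ (k : ℕ) (C : ℝ), ∀ x,
      ‖iteratedFDeriv ℝ n (pint i j G) x‖ ≤ C * (1 + ‖x‖) ^ k := by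
  induction n generalizing F with
  | zero =>
    refine ⟨contDiff_zero.2 (continuous_iff_continuousAt.2 fun p =>
      (pint_hasFDerivAt i j hj G hG p).continuousAt), ?_⟩
    obtain ⟨k, C, hC, h⟩ := pint_bound i j hj _ hG
    refine ⟨k, C, fun x => ?_⟩
    rw [norm_iteratedFDeriv_zero]
    have := intervalIntegral.norm_integral_le_of_norm_le_const (a := (0:ℝ)) (b := 1)
      (f := fun s => G (j s + i x)) (C := C * (1 + ‖x‖) ^ k) (fun s hs => h x s (by
        rw [Set.uIoc_of_le zero_le_one] at hs; exact Set.Ioc_subset_Icc_self hs))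
    simpa [pint] using this
  | succ n ih =>
    obtain ⟨h1, k, C, h2⟩ := ih _ (dI_tg i hG)
    have e : fderiv ℝ (pint i j G) = pint i j (dI i G) :=
      funext fun p => (pint_hasFDerivAt i j hj G hG p).fderiv
    refine ⟨?_, k, C, fun x => ?_⟩
    · push_cast
      rw [contDiff_succ_iff_fderiv]
      exact ⟨fun p => (pint_hasFDerivAt i j hj G hG p).differentiableAt, by simp, by rwa [e]⟩
    · rw [← norm_iteratedFDeriv_fderiv, e]
      exact h2 x

theorem pint_tg (hj : Continuous j) {F : Type*} [NormedAddCommGroup F] [NormedSpace ℝ F]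
    {G : E' → F} (hG : G.HasTemperateGrowth) : (pint i j G).HasTemperateGrowth :=
  ⟨contDiff_infty.2 fun n => (pint_aux i j hj n G hG).1, fun n => (pint_aux i j hj n G hG).2⟩

theorem poly_tg {d : ℕ} {A : Ed d → Ed d} (hA : IsPolyVF A) : A.HasTemperateGrowth :=
  ⟨hA.1, fun n => by obtain ⟨C, k, h⟩ := hA.2 n; exact ⟨k, C, h⟩⟩

theorem lineInt_tg {d : ℕ} {A : Ed d → Ed d} (hA : IsPolyVF A) (a b : E →L[ℝ] Ed d) :
    (fun p => lineInt A (a p) (b p)).HasTemperateGrowth := by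
  have h1 : (fun q : ℝ × E => a q.2 + q.1 • (b q.2 - a q.2)).HasTemperateGrowth := by
    have hs : (fun q : ℝ × E => q.2).HasTemperateGrowth :=
      (ContinuousLinearMap.snd ℝ ℝ E).hasTemperateGrowth
    have hf : (fun q : ℝ × E => q.1).HasTemperateGrowth :=
      (ContinuousLinearMap.fst ℝ ℝ E).hasTemperateGrowth
    have ha : (fun q : ℝ × E => a q.2).HasTemperateGrowth := a.hasTemperateGrowth.comp hs
    have hb : (fun q : ℝ × E => b q.2).HasTemperateGrowth := b.hasTemperateGrowth.comp hs
    exact ha.add (hf.smul (hb.sub ha))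
  have h2 : (fun q : ℝ × E => A (a q.2 + q.1 • (b q.2 - a q.2))).HasTemperateGrowth :=
    (poly_tg hA).comp h1
  have h3 := pint_tg (ContinuousLinearMap.inr ℝ ℝ E) (fun s : ℝ => ((s, 0) : ℝ × E))
    (by fun_prop) h2
  have h4 : (fun p : E => b p - a p).HasTemperateGrowth :=
    b.hasTemperateGrowth.sub a.hasTemperateGrowth
  have h5 : (fun p => innerSL ℝ (pint (ContinuousLinearMap.inr ℝ ℝ E)
      (fun s : ℝ => ((s, 0) : ℝ × E))
      (fun q : ℝ × E => A (a q.2 + q.1 • (b q.2 - a q.2))) p) (b p - a p)).HasTemperateGrowth :=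
    (innerSL ℝ).bilinear_hasTemperateGrowth h3 h4
  convert h5 using 1
  funext p
  have hi : IntervalIntegrable (fun s : ℝ => A (a p + s • (b p - a p))) volume 0 1 :=
    (hA.1.continuous.comp (by fun_prop)).intervalIntegrable _ _
  have h6 := ((innerSL ℝ).flip (b p - a p)).intervalIntegral_comp_comm hi
  have h7 : pint (ContinuousLinearMap.inr ℝ ℝ E) (fun s : ℝ => ((s, 0) : ℝ × E))
      (fun q : ℝ × E => A (a q.2 + q.1 • (b q.2 - a q.2))) p =
      ∫ s in (0:ℝ)..1, A (a p + s • (b p - a p)) := by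
    unfold pint
    simp
  rw [h7]
  exact h6

theorem expI_iter (n : ℕ) (t : ℝ) :
    ‖iteratedFDeriv ℝ n (fun t : ℝ => Complex.exp (Complex.I * (t : ℂ))) t‖ ≤ 1 := by
  rw [norm_iteratedFDeriv_eq_norm_iteratedDeriv]
  have : ∀ n : ℕ, iteratedDeriv n (fun t : ℝ => Complex.exp (Complex.I * (t : ℂ))) =
      fun t : ℝ => Complex.I ^ n * Complex.exp (Complex.I * (t : ℂ)) := by
    intro n
    induction n with
    | zero => simp
    | succ n ih =>
      rw [iteratedDeriv_succ, ih]
      funext t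
      have h1 : HasDerivAt (fun t : ℝ => Complex.I * (t : ℂ)) Complex.I t := by
        simpa using (Complex.ofRealCLM.hasDerivAt (x := t)).const_mul Complex.I
      have h2 := (h1.cexp).const_mul (Complex.I ^ n)
      rw [h2.deriv]
      ring
  rw [this n]
  simp only [norm_mul, norm_pow, Complex.norm_I, one_pow, one_mul]
  rw [mul_comm, Complex.norm_exp_ofReal_mul_I]

theorem expI_tg : (fun t : ℝ => Complex.exp (Complex.I * (t : ℂ))).HasTemperateGrowth := by
  refine ⟨?_, fun n => ⟨0, 1, fun t => by simpa using expI_iter n t⟩⟩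
  exact (contDiff_const.mul Complex.ofRealCLM.contDiff).cexp

theorem norm_expI (t : ℝ) : ‖Complex.exp (Complex.I * (t : ℂ))‖ = 1 := by
  rw [mul_comm, Complex.norm_exp_ofReal_mul_I]

end Temperate
end MW

namespace MW
open FourierTransform Function

section GFT
set_option linter.unusedSectionVars false

/-- unimodular exponential -/
def ex (t : ℝ) : ℂ := Complex.exp (Complex.I * (t : ℂ))

theorem norm_ex (t : ℝ) : ‖ex t‖ = 1 := norm_expI t

theorem ex_add (s t : ℝ) : ex (s + t) = ex s * ex t := by
  simp only [ex, ← Complex.exp_add, ← mul_add]; push_cast; rfl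

theorem ex_zero : ex 0 = 1 := by simp [ex]

theorem continuous_ex : Continuous ex := expI_tg.1.continuous

theorem ex_tg : ex.HasTemperateGrowth := expI_tg

theorem char_smul {F : Type*} [NormedAddCommGroup F] [NormedSpace ℂ F] (t : ℝ) (v : F) :
    𝐞 t • v = ex (2 * π * t) • v := by
  rw [Circle.smul_def, Real.fourierChar_apply, ex, mul_comm]

variable {E W : Type} [NormedAddCommGroup E] [NormedSpace ℝ E]
  [NormedAddCommGroup W] [InnerProductSpace ℝ W] [FiniteDimensional ℝ W]
  [MeasurableSpace W] [BorelSpace W] (S : Spl E W)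

/-- scaling of the second component -/
def scl (s : ℝ) : E →L[ℝ] E := S.ρ + s • S.ι.comp S.pr

theorem scl_apply (s : ℝ) (p : E) : scl S s p = S.ρ p + S.ι (s • S.pr p) := by
  simp [scl]

theorem scl_upper (s : ℝ) (hs : s ≠ 0) :
    ∃ (k : ℕ) (C : ℝ), ∀ p, ‖p‖ ≤ C * (1 + ‖scl S s p‖) ^ k := by
  refine ⟨1, ‖scl S s⁻¹‖, fun p => ?_⟩
  have h : p = scl S s⁻¹ (scl S s p) := by
    rw [scl_apply S s⁻¹, scl_apply S s, S.ρ_pt, S.pr_pt, smul_smul, inv_mul_cancel₀ hs, one_smul,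
      S.dec]
  conv_lhs => rw [h]
  refine (ContinuousLinearMap.le_opNorm _ _).trans ?_
  rw [pow_one]
  gcongr
  linarith

/-- partial Fourier transform with kernel `e^{i t w·v}` -/
def gft (t : ℝ) (ht : t ≠ 0) (F : Type*) [NormedAddCommGroup F] [NormedSpace ℂ F] :
    𝓢(E, F) →L[ℂ] 𝓢(E, F) :=
  (SchwartzMap.compCLM ℂ (scl S (-t / (2 * π))).hasTemperateGrowth
    (scl_upper S _ (div_ne_zero (neg_ne_zero.2 ht) (by positivity)))).comp (pftCLM S F)

variable {F : Type*} [NormedAddCommGroup F] [NormedSpace ℂ F]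

theorem gft_fourier (t : ℝ) (ht : t ≠ 0) (Q : 𝓢(E, F)) (p : E) :
    gft S t ht F Q p = 𝓕 (slice S p Q : W → F) ((-t / (2 * π)) • S.pr p) := by
  have h : gft S t ht F Q p = pft S Q (scl S (-t / (2 * π)) p) := rfl
  rw [h, pft, scl_apply, S.ρ_pt, S.pr_pt]
  rfl

theorem gft_apply (t : ℝ) (ht : t ≠ 0) (Q : 𝓢(E, F)) (p : E) :
    gft S t ht F Q p = ∫ w, ex (t * inner ℝ w (S.pr p)) • Q (S.ρ p + S.ι w) := by
  rw [gft_fourier, Real.fourier_eq]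
  refine integral_congr_ae (Filter.Eventually.of_forall fun w => ?_)
  simp only [char_smul, slice_apply]
  congr 2
  rw [inner_smul_right]
  field_simp

theorem gft_inv [CompleteSpace F] (t : ℝ) (ht : t = 1 ∨ t = -1) (ht0 : t ≠ 0) (ht1 : -t ≠ 0)
    (Q : 𝓢(E, F)) :
    gft S (-t) ht1 F (gft S t ht0 F Q) = ((2 * π) ^ Module.finrank ℝ W : ℝ) • Q := by
  ext p
  rw [gft_apply]
  have h1 : ∀ w : W, gft S t ht0 F Q (S.ρ p + S.ι w) =
      𝓕 (slice S p Q : W → F) ((-t / (2 * π)) • w) := by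
    intro w
    rw [gft_fourier, S.pr_pt]
    have : slice S (S.ρ p + S.ι w) Q = slice S p Q := by
      ext v
      rw [slice_apply, slice_apply, S.ρ_pt]
    rw [this]
  simp only [h1]
  have htt : t * t = 1 := by rcases ht with h | h <;> simp [h]
  have h2 : ∀ w : W, ex (-t * inner ℝ w (S.pr p)) • 𝓕 (slice S p Q : W → F) ((-t / (2 * π)) • w) =
      (fun w' : W => 𝐞 (inner ℝ w' (S.pr p)) • 𝓕 (slice S p Q : W → F) w')
        ((-t / (2 * π)) • w) := by
    intro w
    simp only [char_smul]
    congr 2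
    rw [inner_smul_left]
    simp
    field_simp
  rw [integral_congr_ae (Filter.Eventually.of_forall h2),
    Measure.integral_comp_smul volume
      (fun w' : W => 𝐞 (inner ℝ w' (S.pr p)) • 𝓕 (slice S p Q : W → F) w')]
  have h3 : ∫ w' : W, 𝐞 (inner ℝ w' (S.pr p)) • 𝓕 (slice S p Q : W → F) w' =
      𝓕⁻ (𝓕 (slice S p Q : W → F)) (S.pr p) := (Real.fourierInv_eq _ _).symm
  rw [h3]
  have h4 := (slice S p Q).continuous.fourierInv_fourier_eq (slice S p Q).integrable
    (by
      have : (𝓕 (slice S p Q : W → F)) = (𝓕 (slice S p Q) : 𝓢(W, F)) := by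
        rw [SchwartzMap.fourier_coe]
      rw [this]
      exact SchwartzMap.integrable _)
  rw [h4, slice_apply, S.dec]
  have h5 : |((-t / (2 * π)) ^ Module.finrank ℝ W)⁻¹| = (2 * π) ^ Module.finrank ℝ W := by
    rw [abs_inv, abs_pow, abs_div, abs_neg]
    have : |t| = 1 := by rcases ht with h | h <;> simp [h]
    rw [this, abs_of_pos (by positivity : 0 < 2 * π), div_pow, one_pow, one_div, inv_inv]
  rw [h5]
  rfl

end GFT
end MW

namespace MW
open FourierTransform Function

section Construct
set_option linter.unusedSectionVars false

variable {d : ℕ}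

/-- splitting off the second variable -/
def S₂ (d : ℕ) : Spl (Ed d × Ed d) (Ed d) where
  ρ := (ContinuousLinearMap.inl ℝ (Ed d) (Ed d)).comp (ContinuousLinearMap.fst ℝ (Ed d) (Ed d))
  ι := ContinuousLinearMap.inr ℝ (Ed d) (Ed d)
  pr := ContinuousLinearMap.snd ℝ (Ed d) (Ed d)
  ρι w := by simp
  prι w := by simp
  prρ p := by simp
  dec p := by ext <;> simp

/-- splitting off the first variable -/
def S₁ (d : ℕ) : Spl (Ed d × Ed d) (Ed d) where
  ρ := (ContinuousLinearMap.inr ℝ (Ed d) (Ed d)).comp (ContinuousLinearMap.snd ℝ (Ed d) (Ed d))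
  ι := ContinuousLinearMap.inl ℝ (Ed d) (Ed d)
  pr := ContinuousLinearMap.fst ℝ (Ed d) (Ed d)
  ρι w := by simp
  prι w := by simp
  prρ p := by simp
  dec p := by ext <;> simp

/-- splitting off the last of three variables -/
def S₃ (d : ℕ) : Spl ((Ed d × Ed d) × Ed d) (Ed d) where
  ρ := (ContinuousLinearMap.inl ℝ (Ed d × Ed d) (Ed d)).comp
    (ContinuousLinearMap.fst ℝ (Ed d × Ed d) (Ed d))
  ι := ContinuousLinearMap.inr ℝ (Ed d × Ed d) (Ed d)
  pr := ContinuousLinearMap.snd ℝ (Ed d × Ed d) (Ed d)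
  ρι w := by simp
  prι w := by simp
  prρ p := by simp
  dec p := by ext <;> simp

section
variable {F : Type*} [NormedAddCommGroup F] [NormedSpace ℂ F]

theorem g₂_apply (t : ℝ) (ht : t ≠ 0) (Q : 𝓢(Ed d × Ed d, F)) (x y : Ed d) :
    gft (S₂ d) t ht F Q (x, y) = ∫ w, ex (t * inner ℝ w y) • Q (x, w) := by
  rw [gft_apply]
  simp [S₂]

theorem g₁_apply (t : ℝ) (ht : t ≠ 0) (Q : 𝓢(Ed d × Ed d, F)) (x y : Ed d) :
    gft (S₁ d) t ht F Q (x, y) = ∫ w, ex (t * inner ℝ w x) • Q (w, y) := by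
  rw [gft_apply]
  simp [S₁]

theorem g₃_apply (Q : 𝓢((Ed d × Ed d) × Ed d, F)) (q : Ed d × Ed d) :
    gft (S₃ d) 1 one_ne_zero F Q (q, 0) = ∫ w, Q (q, w) := by
  rw [gft_apply]
  simp [S₃, ex_zero]

variable (d F) in
/-- the (2π)^{-d} normalised partial Fourier transform of a symbol -/
def KC : 𝓢(Ed d × Ed d, F) →L[ℂ] 𝓢(Ed d × Ed d, F) :=
  ((((2 * π) ^ d)⁻¹ : ℝ) : ℂ) • gft (S₂ d) (-1) (by norm_num) F

variable (d F) in
/-- inverse of `KC` -/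
def KI : 𝓢(Ed d × Ed d, F) →L[ℂ] 𝓢(Ed d × Ed d, F) := gft (S₂ d) 1 one_ne_zero F

theorem KC_apply (f : 𝓢(Ed d × Ed d, F)) (x y : Ed d) :
    KC d F f (x, y) = (((2 * π) ^ d)⁻¹ : ℝ) • ∫ η, ex (-inner ℝ η y) • f (x, η) := by
  have : KC d F f (x, y) = ((((2 * π) ^ d)⁻¹ : ℝ) : ℂ) • gft (S₂ d) (-1) (by norm_num) F f (x, y) :=
    rfl
  rw [this, g₂_apply, Complex.coe_smul]
  simp

theorem KI_apply (f : 𝓢(Ed d × Ed d, F)) (x y : Ed d) :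
    KI d F f (x, y) = ∫ η, ex (inner ℝ η y) • f (x, η) := by
  have : KI d F f (x, y) = gft (S₂ d) 1 one_ne_zero F f (x, y) := rfl
  rw [this, g₂_apply]
  simp

theorem KC_KI [CompleteSpace F] (f : 𝓢(Ed d × Ed d, F)) : KC d F (KI d F f) = f := by
  have h := gft_inv (S₂ d) (F := F) 1 (Or.inl rfl) one_ne_zero (by norm_num) f
  have h2 : KC d F (KI d F f) = ((((2 * π) ^ d)⁻¹ : ℝ) : ℂ) •
    gft (S₂ d) (-1) (by norm_num) F (gft (S₂ d) 1 one_ne_zero F f) := rfl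
  rw [h2, h]
  ext p
  change ((((2 * π) ^ d)⁻¹ : ℝ) : ℂ) • (((2 * π) ^ Module.finrank ℝ (Ed d) : ℝ) • f p) = f p
  rw [Complex.coe_smul, smul_smul, finrank_euclideanSpace_fin, inv_mul_cancel₀ (by positivity),
    one_smul]

theorem KI_KC [CompleteSpace F] (f : 𝓢(Ed d × Ed d, F)) : KI d F (KC d F f) = f := by
  have h := gft_inv (S₂ d) (F := F) (-1) (Or.inr rfl) (by norm_num) (by norm_num) f
  have h2 : KI d F (KC d F f) = ((((2 * π) ^ d)⁻¹ : ℝ) : ℂ) •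
    gft (S₂ d) 1 one_ne_zero F (gft (S₂ d) (-1) (by norm_num) F f) := by
    simp [KI, KC]
  simp only [neg_neg] at h
  rw [h2, h]
  ext p
  change ((((2 * π) ^ d)⁻¹ : ℝ) : ℂ) • (((2 * π) ^ Module.finrank ℝ (Ed d) : ℝ) • f p) = f p
  rw [Complex.coe_smul, smul_smul, finrank_euclideanSpace_fin, inv_mul_cancel₀ (by positivity),
    one_smul]

variable (d F) in
/-- the Schwartz version of the symplectic Fourier transform, with swapped variables -/
def FS : 𝓢(Ed d × Ed d, F) →L[ℂ] 𝓢(Ed d × Ed d, F) :=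
  (gft (S₁ d) 1 one_ne_zero F).comp (KC d F)

theorem FS_apply (f : 𝓢(Ed d × Ed d, F)) (η y : Ed d) :
    FS d F f (η, y) = ∫ w, ex (inner ℝ w η) • KC d F f (w, y) := by
  have : FS d F f (η, y) = gft (S₁ d) 1 one_ne_zero F (KC d F f) (η, y) := rfl
  rw [this, g₁_apply]
  simp

theorem FS_inv [CompleteSpace F] (f : 𝓢(Ed d × Ed d, F)) (x y : Ed d) :
    ∫ η, ex (-inner ℝ η x) • FS d F f (η, y) = ((2 * π) ^ d : ℝ) • KC d F f (x, y) := by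
  have h := gft_inv (S₁ d) (F := F) 1 (Or.inl rfl) one_ne_zero (by norm_num) (KC d F f)
  have h1 := congrArg (fun q : 𝓢(Ed d × Ed d, F) => q (x, y)) h
  simp only [g₁_apply (-1 : ℝ)] at h1
  simp only [neg_mul, one_mul, finrank_euclideanSpace_fin] at h1
  exact h1
end

/-- the pair of linear maps for the product -/
def TP (d : ℕ) (ε : ℝ) : Pair ((Ed d × Ed d) × Ed d) (Ed d × Ed d) (Ed d × Ed d) where
  a := ((ContinuousLinearMap.fst ℝ (Ed d) (Ed d)).comp (ContinuousLinearMap.fst ℝ _ _) -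
      (ε / 2) • ((ContinuousLinearMap.snd ℝ (Ed d) (Ed d)).comp (ContinuousLinearMap.fst ℝ _ _) -
      ContinuousLinearMap.snd ℝ (Ed d × Ed d) (Ed d))).prod
        (ContinuousLinearMap.snd ℝ (Ed d × Ed d) (Ed d))
  b := ((ContinuousLinearMap.fst ℝ (Ed d) (Ed d)).comp (ContinuousLinearMap.fst ℝ _ _) +
      (ε / 2) • ContinuousLinearMap.snd ℝ (Ed d × Ed d) (Ed d)).prod
      ((ContinuousLinearMap.snd ℝ (Ed d) (Ed d)).comp (ContinuousLinearMap.fst ℝ _ _) -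
      ContinuousLinearMap.snd ℝ (Ed d × Ed d) (Ed d))
  c := 1 + |ε / 2|
  hc := by positivity
  le := by
    rintro ⟨⟨x, w⟩, y⟩
    simp only [ContinuousLinearMap.prod_apply, ContinuousLinearMap.add_apply,
      ContinuousLinearMap.sub_apply, ContinuousLinearMap.smul_apply, ContinuousLinearMap.comp_apply,
      ContinuousLinearMap.coe_fst', ContinuousLinearMap.coe_snd', Prod.norm_mk]
    set a := max ‖x - (ε / 2) • (w - y)‖ ‖y‖ with ha
    set b := max ‖x + (ε / 2) • y‖ ‖w - y‖ with hb
    have h1 : ‖y‖ ≤ a := le_max_right _ _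
    have h2 : ‖w - y‖ ≤ b := le_max_right _ _
    have h3 : ‖x + (ε / 2) • y‖ ≤ b := le_max_left _ _
    have h4 : ‖w‖ ≤ ‖w - y‖ + ‖y‖ := by simpa using norm_add_le (w - y) y
    have h5 : ‖x‖ ≤ ‖x + (ε / 2) • y‖ + |ε / 2| * ‖y‖ := by
      have := norm_sub_le (x + (ε / 2) • y) ((ε / 2) • y)
      rwa [add_sub_cancel_right, norm_smul, Real.norm_eq_abs] at this
    have h6 : 0 ≤ |ε / 2| := abs_nonneg _
    have ha0 : 0 ≤ a := (norm_nonneg _).trans h1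
    have hb0 : 0 ≤ b := (norm_nonneg _).trans h2
    refine max_le (max_le ?_ ?_) ?_
    · nlinarith [mul_le_mul_of_nonneg_left h1 h6]
    · nlinarith
    · nlinarith

theorem TP_a (ε : ℝ) (x w y : Ed d) : (TP d ε).a ((x, w), y) = (x - (ε / 2) • (w - y), y) := rfl
theorem TP_b (ε : ℝ) (x w y : Ed d) : (TP d ε).b ((x, w), y) = (x + (ε / 2) • y, w - y) := rfl

/-- the magnetic phase factor -/
def theta (ε lam : ℝ) (A : Ed d → Ed d) (p : (Ed d × Ed d) × Ed d) : ℂ :=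
  ex (-(lam * gammaB ε A p.1.1 p.2 (p.1.2 - p.2)))

theorem flux_tg {A : Ed d → Ed d} (hA : IsPolyVF A) {E : Type} [NormedAddCommGroup E]
    [NormedSpace ℝ E] (a b c : E →L[ℝ] Ed d) :
    (fun p => fluxTriangle A (a p) (b p) (c p)).HasTemperateGrowth := by
  have : (fun p => fluxTriangle A (a p) (b p) (c p)) = fun p =>
      lineInt A (a p) (b p) + lineInt A (b p) (c p) - lineInt A (a p) (c p) :=
    funext fun p => stokes A hA.1 _ _ _
  rw [this]
  exact ((lineInt_tg hA a b).add (lineInt_tg hA b c)).sub (lineInt_tg hA a c)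

theorem gamma_tg (ε : ℝ) {A : Ed d → Ed d} (hA : IsPolyVF A) {E : Type} [NormedAddCommGroup E]
    [NormedSpace ℝ E] (a b c : E →L[ℝ] Ed d) :
    (fun p => gammaB ε A (a p) (b p) (c p)).HasTemperateGrowth := by
  exact (Function.HasTemperateGrowth.const ε⁻¹).mul (flux_tg hA (a - (ε / 2) • (b + c))
    (a + (ε / 2) • (b - c)) (a + (ε / 2) • (b + c)))

theorem theta_tg (ε lam : ℝ) {A : Ed d → Ed d} (hA : IsPolyVF A) :
    (theta ε lam A).HasTemperateGrowth := by
  have h := gamma_tg ε hA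
    ((ContinuousLinearMap.fst ℝ (Ed d) (Ed d)).comp (ContinuousLinearMap.fst ℝ (Ed d × Ed d) (Ed d)))
    (ContinuousLinearMap.snd ℝ (Ed d × Ed d) (Ed d))
    ((ContinuousLinearMap.snd ℝ (Ed d) (Ed d)).comp (ContinuousLinearMap.fst ℝ _ _) -
      ContinuousLinearMap.snd ℝ (Ed d × Ed d) (Ed d))
  exact ex_tg.comp (((Function.HasTemperateGrowth.const lam).mul h).neg)

/-- restriction to `y = 0` -/
def rst (d : ℕ) (F : Type*) [NormedAddCommGroup F] [NormedSpace ℂ F] :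
    𝓢((Ed d × Ed d) × Ed d, F) →L[ℂ] 𝓢(Ed d × Ed d, F) :=
  SchwartzMap.compCLM ℂ (ContinuousLinearMap.inl ℝ (Ed d × Ed d) (Ed d)).hasTemperateGrowth
    ⟨1, 1, fun p => by simp⟩

theorem rst_apply {F : Type*} [NormedAddCommGroup F] [NormedSpace ℂ F]
    (Q : 𝓢((Ed d × Ed d) × Ed d, F)) (p : Ed d × Ed d) : rst d F Q p = Q (p, 0) := rfl

/-- linear part of the product -/
def lin (ε lam : ℝ) (A : Ed d → Ed d) (F : Type*) [NormedAddCommGroup F] [NormedSpace ℂ F] :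
    𝓢((Ed d × Ed d) × Ed d, F) →L[ℂ] 𝓢(Ed d × Ed d, F) :=
  (KI d F).comp ((rst d F).comp ((gft (S₃ d) 1 one_ne_zero F).comp
    (smulLeftCLM F (theta ε lam A))))

variable {H H' H'' : Type*}
    [NormedAddCommGroup H] [NormedSpace ℂ H] [NormedAddCommGroup H'] [NormedSpace ℂ H']
    [NormedAddCommGroup H''] [NormedSpace ℂ H'']

variable (H H' H'') in
/-- the magnetic Weyl product -/
def prodW (ε lam : ℝ) (A : Ed d → Ed d) :
    𝓢(Ed d × Ed d, H' →L[ℂ] H'') →L[ℂ] 𝓢(Ed d × Ed d, H →L[ℂ] H') →L[ℂ]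
      𝓢(Ed d × Ed d, H →L[ℂ] H'') :=
  (ContinuousLinearMap.postcomp _ (lin ε lam A (H →L[ℂ] H''))).comp
    ((ContinuousLinearMap.precomp _ (KC d (H →L[ℂ] H'))).comp
      ((tens (TP d ε) (ContinuousLinearMap.compL ℂ H H' H'')).comp (KC d (H' →L[ℂ] H''))))

theorem prodW_eq (ε lam : ℝ) (A : Ed d → Ed d) (f : 𝓢(Ed d × Ed d, H' →L[ℂ] H''))
    (g : 𝓢(Ed d × Ed d, H →L[ℂ] H')) :
    prodW H H' H'' ε lam A f g = lin ε lam A (H →L[ℂ] H'')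
      (tens (TP d ε) (ContinuousLinearMap.compL ℂ H H' H'') (KC d _ f) (KC d _ g)) := rfl

/-- the integrand `Q` of the product -/
def QQ (ε lam : ℝ) (A : Ed d → Ed d) (f : 𝓢(Ed d × Ed d, H' →L[ℂ] H''))
    (g : 𝓢(Ed d × Ed d, H →L[ℂ] H')) : 𝓢((Ed d × Ed d) × Ed d, H →L[ℂ] H'') :=
  smulLeftCLM _ (theta ε lam A)
    (tens (TP d ε) (ContinuousLinearMap.compL ℂ H H' H'') (KC d _ f) (KC d _ g))

theorem QQ_apply (ε lam : ℝ) {A : Ed d → Ed d} (hA : IsPolyVF A)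
    (f : 𝓢(Ed d × Ed d, H' →L[ℂ] H'')) (g : 𝓢(Ed d × Ed d, H →L[ℂ] H')) (x w y : Ed d) :
    QQ ε lam A f g ((x, w), y) = ex (-(lam * gammaB ε A x y (w - y))) •
      ((KC d _ f (x - (ε / 2) • (w - y), y)).comp (KC d _ g (x + (ε / 2) • y, w - y))) := by
  rw [QQ, smulLeftCLM_apply_apply (theta_tg ε lam hA), tens_apply, TP_a, TP_b]
  rfl

/-- the kernel `R` -/
def RR (ε lam : ℝ) (A : Ed d → Ed d) (f : 𝓢(Ed d × Ed d, H' →L[ℂ] H''))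
    (g : 𝓢(Ed d × Ed d, H →L[ℂ] H')) : 𝓢(Ed d × Ed d, H →L[ℂ] H'') :=
  rst d _ (gft (S₃ d) 1 one_ne_zero _ (QQ ε lam A f g))

theorem RR_apply (ε lam : ℝ) (A : Ed d → Ed d) (f : 𝓢(Ed d × Ed d, H' →L[ℂ] H''))
    (g : 𝓢(Ed d × Ed d, H →L[ℂ] H')) (q : Ed d × Ed d) :
    RR ε lam A f g q = ∫ y, QQ ε lam A f g (q, y) := by
  rw [RR, rst_apply, g₃_apply]

theorem prodW_KI (ε lam : ℝ) (A : Ed d → Ed d) (f : 𝓢(Ed d × Ed d, H' →L[ℂ] H''))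
    (g : 𝓢(Ed d × Ed d, H →L[ℂ] H')) :
    prodW H H' H'' ε lam A f g = KI d _ (RR ε lam A f g) := rfl

theorem KC_prodW [CompleteSpace H''] (ε lam : ℝ) (A : Ed d → Ed d)
    (f : 𝓢(Ed d × Ed d, H' →L[ℂ] H'')) (g : 𝓢(Ed d × Ed d, H →L[ℂ] H')) :
    KC d _ (prodW H H' H'' ε lam A f g) = RR ε lam A f g := by
  rw [prodW_KI, KC_KI]

theorem flux_congr {A A' : Ed d → Ed d} (h : ∀ x j l, Bcomp A' x j l = Bcomp A x j l) :
    fluxTriangle A' = fluxTriangle A := by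
  funext a b c
  simp only [fluxTriangle, h]

theorem gamma_congr (ε : ℝ) {A A' : Ed d → Ed d} (h : ∀ x j l, Bcomp A' x j l = Bcomp A x j l) :
    gammaB ε A' = gammaB ε A := by
  funext a b c
  simp only [gammaB, flux_congr h]

theorem prodW_congr (ε lam : ℝ) {A A' : Ed d → Ed d}
    (h : ∀ x j l, Bcomp A' x j l = Bcomp A x j l) :
    prodW H H' H'' ε lam A' = prodW H H' H'' ε lam A := by
  have : theta ε lam A' = theta ε lam A := by
    funext p
    simp only [theta, gamma_congr ε h]
  unfold prodW lin
  rw [this]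

end Construct
end MW

namespace MW
open FourierTransform Function

section Comp
set_option linter.unusedSectionVars false

variable {d : ℕ}
variable {H H' H'' : Type*}
    [NormedAddCommGroup H] [NormedSpace ℂ H] [NormedAddCommGroup H'] [NormedSpace ℂ H']
    [NormedAddCommGroup H''] [NormedSpace ℂ H'']

/-- the integral kernel of the quantization -/
def ker (ε lam : ℝ) (A : Ed d → Ed d) (f : 𝓢(Ed d × Ed d, H →L[ℂ] H')) (x y : Ed d) : H →L[ℂ] H' :=
  ex (-(lam / ε * lineInt A (ε • x) (ε • y))) • KC d _ f ((ε / 2) • (x + y), y - x)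

theorem wPhase_eq (ε lam : ℝ) (A : Ed d → Ed d) (x y η : Ed d) :
    wPhase ε lam A x y η =
      ex (-(lam / ε * lineInt A (ε • x) (ε • y))) * ex (-inner ℝ η (y - x)) := by
  rw [wPhase, ex, ex, mul_comm, real_inner_comm]
  congr 2 <;> push_cast <;> ring

theorem symb_integrable {F : Type*} [NormedAddCommGroup F] [NormedSpace ℂ F]
    (f : 𝓢(Ed d × Ed d, F)) (x : Ed d) : Integrable fun η => f (x, η) := by
  have h := (slice (S₂ d) (x, 0) f).integrable (μ := volume)
  refine h.congr (Filter.Eventually.of_forall fun w => ?_)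
  change slice (S₂ d) (x, 0) f w = f (x, w)
  rw [slice_apply]
  simp [S₂]

theorem integrable_ex_smul {F α : Type*} [NormedAddCommGroup F] [NormedSpace ℂ F]
    [TopologicalSpace α] [MeasurableSpace α] [OpensMeasurableSpace α] [SecondCountableTopology α]
    {μ : Measure α} {φ : α → ℝ} (hφ : Continuous φ) {f : α → F} (hf : Integrable f μ) :
    Integrable (fun a => ex (φ a) • f a) μ := by
  refine hf.mono ((continuous_ex.comp hφ).aestronglyMeasurable.smul hf.1)
    (Filter.Eventually.of_forall fun a => ?_)
  rw [norm_smul, norm_ex, one_mul]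

theorem opA_ker [CompleteSpace H'] (ε lam : ℝ) (A : Ed d → Ed d)
    (f : 𝓢(Ed d × Ed d, H →L[ℂ] H')) (Ψ : Ed d → H) (x : Ed d) :
    opA ε lam A f Ψ x = ∫ y, ker ε lam A f x y (Ψ y) := by
  rw [opA, ← integral_smul]
  refine integral_congr_ae (Filter.Eventually.of_forall fun y => ?_)
  simp only [ker, KC_apply, wPhase_eq]
  have hi : Integrable fun η => ex (-inner ℝ η (y - x)) • f ((ε / 2) • (x + y), η) :=
    integrable_ex_smul (by fun_prop) (symb_integrable f _)
  simp only [mul_smul, integral_smul]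
  rw [_root_.smul_apply, _root_.smul_apply,
    ContinuousLinearMap.integral_apply hi, smul_comm]
  rfl

theorem ker_continuous (ε lam : ℝ) {A : Ed d → Ed d} (hA : IsPolyVF A)
    (f : 𝓢(Ed d × Ed d, H →L[ℂ] H')) :
    Continuous fun p : Ed d × Ed d => ker ε lam A f p.1 p.2 := by
  have h := (lineInt_tg hA (ε • ContinuousLinearMap.fst ℝ (Ed d) (Ed d))
    (ε • ContinuousLinearMap.snd ℝ (Ed d) (Ed d))).1.continuous
  have h1 : Continuous fun p : Ed d × Ed d => lineInt A (ε • p.1) (ε • p.2) := h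
  unfold ker
  refine (continuous_ex.comp (by fun_prop)).smul ((KC d _ f).continuous.comp (by fun_prop))

theorem ker_cont_right (ε lam : ℝ) {A : Ed d → Ed d} (hA : IsPolyVF A)
    (f : 𝓢(Ed d × Ed d, H →L[ℂ] H')) (x : Ed d) : Continuous fun y => ker ε lam A f x y := by
  have h := (ker_continuous ε lam hA f).comp (Continuous.prodMk_right x)
  exact h

theorem ker_cont_left (ε lam : ℝ) {A : Ed d → Ed d} (hA : IsPolyVF A)
    (f : 𝓢(Ed d × Ed d, H →L[ℂ] H')) (x : Ed d) : Continuous fun y => ker ε lam A f y x := by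
  have h := (ker_continuous ε lam hA f).comp (Continuous.prodMk_left x)
  exact h

theorem ker_bound (ε lam : ℝ) (A : Ed d → Ed d) (f : 𝓢(Ed d × Ed d, H →L[ℂ] H')) :
    ∃ C : ℝ, ∀ x y, ‖ker ε lam A f x y‖ ≤ C :=
  ⟨SchwartzMap.seminorm ℝ 0 0 (KC d _ f), fun x y => by
    rw [ker, norm_smul, norm_ex, one_mul]
    exact SchwartzMap.norm_le_seminorm ℝ _ _⟩

theorem ker_integrable (ε lam : ℝ) {A : Ed d → Ed d} (hA : IsPolyVF A)
    (f : 𝓢(Ed d × Ed d, H →L[ℂ] H')) (x : Ed d) : Integrable fun y => ker ε lam A f x y := by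
  have htg : (fun y : Ed d => ((ε / 2) • (x + y), y - x)).HasTemperateGrowth := by
    have h1 := (Function.HasTemperateGrowth.const (E := Ed d) (((ε / 2) • x, -x) : Ed d × Ed d)).add
      (((ε / 2) • ContinuousLinearMap.id ℝ (Ed d)).prod
        (ContinuousLinearMap.id ℝ (Ed d))).hasTemperateGrowth
    convert h1 using 1
    funext y
    ext1
    · simp [smul_add]
    · simp; abel
  let g : 𝓢(Ed d, H →L[ℂ] H') := SchwartzMap.compCLM ℂ htg ⟨1, 1 + ‖x‖, fun y => by
    have h1 : ‖y‖ ≤ ‖y - x‖ + ‖x‖ := by simpa using norm_add_le (y - x) x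
    have h2 : ‖y - x‖ ≤ ‖((ε / 2) • (x + y), y - x)‖ := by rw [Prod.norm_mk]; exact le_max_right _ _
    have h3 := norm_nonneg x
    have h4 := norm_nonneg (y - x)
    rw [pow_one]
    nlinarith⟩ (KC d _ f)
  have hg := g.integrable (μ := volume)
  have hc : Continuous fun y => ker ε lam A f x y :=
    ker_cont_right ε lam hA f x
  refine hg.mono hc.aestronglyMeasurable (Filter.Eventually.of_forall fun y => ?_)
  rw [ker, norm_smul, norm_ex, one_mul]
  exact le_of_eq rfl

theorem ker_comp (ε lam : ℝ) {A : Ed d → Ed d} (hA : IsPolyVF A)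
    (f : 𝓢(Ed d × Ed d, H' →L[ℂ] H'')) (g : 𝓢(Ed d × Ed d, H →L[ℂ] H')) [CompleteSpace H'']
    (x z : Ed d) :
    ∫ y, (ker ε lam A f x y).comp (ker ε lam A g y z) =
      ker ε lam A (prodW H H' H'' ε lam A f g) x z := by
  rw [ker, KC_prodW, RR_apply, ← integral_smul, ← integral_add_left_eq_self _ x]
  refine integral_congr_ae (Filter.Eventually.of_forall fun y => ?_)
  simp only [QQ_apply ε lam hA, ker, ContinuousLinearMap.comp_smul, ContinuousLinearMap.smul_comp,
    smul_smul, ← ex_add]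
  have e1 : (ε / 2) • (x + z) - (ε / 2) • (z - x - y) = (ε / 2) • (x + (x + y)) := by module
  have e2 : (ε / 2) • (x + z) + (ε / 2) • y = (ε / 2) • (x + y + z) := by module
  have e3 : x + y - x = y := by abel
  have e4 : z - x - y = z - (x + y) := by abel
  rw [e1, e2, e3]
  rw [gammaB, stokes A hA.1]
  have c0 : (ε / 2) • (x + z) - (ε / 2) • (y + (z - x - y)) = ε • x := by module
  have c1 : (ε / 2) • (x + z) + (ε / 2) • (y - (z - x - y)) = ε • (x + y) := by module
  have c2 : (ε / 2) • (x + z) + (ε / 2) • (y + (z - x - y)) = ε • z := by module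
  rw [c0, c1, c2, e4]
  congr 2
  ring

theorem opA_comp [CompleteSpace H'] [CompleteSpace H''] (ε lam : ℝ) {A : Ed d → Ed d}
    (hA : IsPolyVF A)
    (f : 𝓢(Ed d × Ed d, H' →L[ℂ] H'')) (g : 𝓢(Ed d × Ed d, H →L[ℂ] H'))
    (Ψ : 𝓢(Ed d, H)) (x : Ed d) :
    opA ε lam A (prodW H H' H'' ε lam A f g) Ψ x = opA ε lam A f (opA ε lam A g Ψ) x := by
  obtain ⟨C, hC⟩ := ker_bound ε lam A g
  have hf := ker_continuous ε lam hA f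
  have hg := ker_continuous ε lam hA g
  rw [opA_ker, opA_ker]
  have hΨ : Integrable Ψ (volume : Measure (Ed d)) := Ψ.integrable
  have h1 : ∀ y, ker ε lam A f x y (opA ε lam A g Ψ y) =
      ∫ z, ker ε lam A f x y (ker ε lam A g y z (Ψ z)) := by
    intro y
    rw [opA_ker]
    refine ((ker ε lam A f x y).integral_comp_comm ?_).symm
    have hc : Continuous fun z => ker ε lam A g y z (Ψ z) :=
      (ker_cont_right ε lam hA g y).clm_apply Ψ.continuous
    refine (hΨ.norm.const_mul C).mono' hc.aestronglyMeasurable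
      (Filter.Eventually.of_forall fun z => ?_)
    exact (ContinuousLinearMap.le_opNorm _ _).trans
      (mul_le_mul_of_nonneg_right (hC y z) (norm_nonneg _))
  simp only [h1]
  have hcf : Continuous fun p : Ed d × Ed d => ker ε lam A f x p.1 :=
    (ker_cont_right ε lam hA f x).comp continuous_fst
  have hI : Integrable (uncurry fun y z => ker ε lam A f x y (ker ε lam A g y z (Ψ z)))
      ((volume : Measure (Ed d)).prod (volume : Measure (Ed d))) := by
    have hc : Continuous (uncurry fun y z => ker ε lam A f x y (ker ε lam A g y z (Ψ z))) := by
      exact hcf.clm_apply (hg.clm_apply (Ψ.continuous.comp continuous_snd))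
    refine ((ker_integrable ε lam hA f x).norm.mul_prod (hΨ.norm.const_mul C)).mono'
      hc.aestronglyMeasurable (Filter.Eventually.of_forall fun p => ?_)
    refine (ContinuousLinearMap.le_opNorm _ _).trans ?_
    refine mul_le_mul_of_nonneg_left ?_ (norm_nonneg _)
    exact (ContinuousLinearMap.le_opNorm _ _).trans
      (mul_le_mul_of_nonneg_right (hC _ _) (norm_nonneg _))
  rw [integral_integral_swap hI]
  refine integral_congr_ae (Filter.Eventually.of_forall fun z => ?_)
  have hJ : Integrable fun y => (ker ε lam A f x y).comp (ker ε lam A g y z) := by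
    have hc : Continuous fun y => (ker ε lam A f x y).comp (ker ε lam A g y z) :=
      (ker_cont_right ε lam hA f x).clm_comp
        (ker_cont_left ε lam hA g z)
    refine ((ker_integrable ε lam hA f x).norm.mul_const C).mono'
      hc.aestronglyMeasurable (Filter.Eventually.of_forall fun p => ?_)
    refine (ContinuousLinearMap.opNorm_comp_le _ _).trans ?_
    exact mul_le_mul_of_nonneg_left (hC _ _) (norm_nonneg _)
  simp only
  rw [← ker_comp ε lam hA, ContinuousLinearMap.integral_apply hJ]
  rfl

end Comp
end MW

namespace MW
open FourierTransform Function

section Inj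
set_option linter.unusedSectionVars false

variable {d : ℕ}
variable {H H' H'' : Type*}
    [NormedAddCommGroup H] [NormedSpace ℂ H] [NormedAddCommGroup H'] [NormedSpace ℂ H']

theorem opA_inj [CompleteSpace H'] (ε lam : ℝ) (hε : 0 < ε) {A : Ed d → Ed d} (hA : IsPolyVF A)
    (f g : 𝓢(Ed d × Ed d, H →L[ℂ] H'))
    (h : ∀ (Ψ : 𝓢(Ed d, H)) (x : Ed d), opA ε lam A f Ψ x = opA ε lam A g Ψ x) : f = g := by
  have key : ∀ x y (v : H), ker ε lam A f x y v = ker ε lam A g x y v := by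
    intro x y v
    have cf : Continuous fun y => ker ε lam A f x y v :=
      (ker_cont_right ε lam hA f x).clm_apply continuous_const
    have cg : Continuous fun y => ker ε lam A g x y v :=
      (ker_cont_right ε lam hA g x).clm_apply continuous_const
    have hae := ae_eq_of_integral_contDiff_smul_eq (μ := (volume : Measure (Ed d)))
      cf.locallyIntegrable cg.locallyIntegrable (fun φ hφ hs => by
        have hs' : HasCompactSupport fun y => φ y • v := hs.smul_right
        have := h (hs'.toSchwartzMap (hφ.smul contDiff_const)) x
        rw [opA_ker, opA_ker] at this
        have e : ∀ y, (hs'.toSchwartzMap (hφ.smul contDiff_const)) y = ((φ y : ℝ) : ℂ) • v :=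
          fun y => by rw [Complex.coe_smul]; rfl
        simp only [e, map_smul] at this
        simpa only [Complex.coe_smul] using this)
    exact congrFun (cf.ae_eq_iff_eq volume cg |>.1 hae) y
  have hK : KC d _ f = KC d _ g := by
    ext p v
    obtain ⟨u, w⟩ := p
    have h1 := key (ε⁻¹ • u - (2 : ℝ)⁻¹ • w) (ε⁻¹ • u + (2 : ℝ)⁻¹ • w) v
    simp only [ker, _root_.smul_apply] at h1
    have hne : ∀ t, ex t ≠ 0 := fun t ht => by
      have := norm_ex t
      rw [ht, norm_zero] at this
      exact zero_ne_one this
    have h2 := smul_right_injective H' (hne _) h1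
    have e1 : (ε / 2) • (ε⁻¹ • u - (2 : ℝ)⁻¹ • w + (ε⁻¹ • u + (2 : ℝ)⁻¹ • w)) = u := by
      have : (ε / 2) • (ε⁻¹ • u - (2 : ℝ)⁻¹ • w + (ε⁻¹ • u + (2 : ℝ)⁻¹ • w)) = (ε * ε⁻¹) • u := by
        module
      rw [this, mul_inv_cancel₀ hε.ne', one_smul]
    have e2 : (ε⁻¹ • u + (2 : ℝ)⁻¹ • w) - (ε⁻¹ • u - (2 : ℝ)⁻¹ • w) = w := by module
    simp only [e1, e2] at h2
    exact h2
  rw [← KI_KC f, hK, KI_KC]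

end Inj
end MW

namespace MW
open FourierTransform Function

section Formula
set_option linter.unusedSectionVars false

variable {d : ℕ}

section
variable {F : Type*} [NormedAddCommGroup F] [NormedSpace ℂ F]

instance instTG (d : ℕ) : (volume : Measure (Ed d × Ed d)).HasTemperateGrowth := by
  have h : (volume : Measure (Ed d × Ed d)).IsAddHaarMeasure :=
    Measure.prod.instIsAddHaarMeasure (volume : Measure (Ed d)) (volume : Measure (Ed d))
  infer_instance

theorem symb_integrable₁ (f : 𝓢(Ed d × Ed d, F)) (y : Ed d) : Integrable fun η => f (η, y) := by
  have h := (slice (S₁ d) (0, y) f).integrable (μ := volume)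
  refine h.congr (Filter.Eventually.of_forall fun w => ?_)
  change slice (S₁ d) (0, y) f w = f (w, y)
  rw [slice_apply]
  simp [S₁]

theorem fourierSymp_eq (f : 𝓢(Ed d × Ed d, F)) (Y : Ed d × Ed d) :
    fourierSymp f Y = FS d F f Y.swap := by
  obtain ⟨y, η⟩ := Y
  have hc : Continuous fun Z : Ed d × Ed d => symp (y, η) Z := by
    unfold symp; fun_prop
  have hi : Integrable (fun Z : Ed d × Ed d => ex (symp (y, η) Z) • f Z) volume :=
    integrable_ex_smul hc f.integrable
  have h1 : fourierSymp f (y, η) = (((2 * π) ^ d)⁻¹ : ℝ) •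
      ∫ Z : Ed d × Ed d, ex (symp (y, η) Z) • f Z := rfl
  rw [h1, Measure.volume_eq_prod, integral_prod _ hi, Prod.swap_prod_mk, FS_apply, ← integral_smul]
  refine integral_congr_ae (Filter.Eventually.of_forall fun w => ?_)
  simp only [KC_apply]
  rw [smul_comm]
  congr 1
  rw [← integral_smul]
  refine integral_congr_ae (Filter.Eventually.of_forall fun ω => ?_)
  simp only [smul_smul, ← ex_add]
  congr 2
  simp only [symp]
  rw [real_inner_comm, real_inner_comm ω]
  ring

theorem slice3_integrable (Q : 𝓢((Ed d × Ed d) × Ed d, F)) (x : Ed d) :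
    Integrable (fun p : Ed d × Ed d => Q ((x, p.1), p.2)) volume := by
  have htg : (fun p : Ed d × Ed d => ((x, p.1), p.2)).HasTemperateGrowth := by
    have h1 := (Function.HasTemperateGrowth.const (E := Ed d × Ed d)
      (((x, 0), 0) : (Ed d × Ed d) × Ed d)).add
      ((((0 : Ed d × Ed d →L[ℝ] Ed d).prod (ContinuousLinearMap.fst ℝ (Ed d) (Ed d))).prod
        (ContinuousLinearMap.snd ℝ (Ed d) (Ed d)))).hasTemperateGrowth
    convert h1 using 1
    funext p
    simp
  let g : 𝓢(Ed d × Ed d, F) := SchwartzMap.compCLM ℂ htg ⟨1, 1, fun p => by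
    rw [pow_one, one_mul, Prod.norm_mk, Prod.norm_mk]
    obtain ⟨a, b⟩ := p
    rw [Prod.norm_mk]
    have h1 : max ‖a‖ ‖b‖ ≤ max (max ‖x‖ ‖a‖) ‖b‖ := max_le_max (le_max_right _ _) le_rfl
    simp only
    linarith⟩ Q
  exact g.integrable
end

variable {H H' H'' : Type*}
    [NormedAddCommGroup H] [NormedSpace ℂ H] [NormedAddCommGroup H'] [NormedSpace ℂ H']
    [NormedAddCommGroup H''] [NormedSpace ℂ H'']

theorem comp_prod_integrable {α β : Type*} [TopologicalSpace α] [TopologicalSpace β]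
    [MeasurableSpace α] [MeasurableSpace β] [BorelSpace α] [BorelSpace β]
    [SecondCountableTopology α] [SecondCountableTopology β] {μ : Measure α} {ν : Measure β}
    [SFinite μ] [SFinite ν]
    {a : α → H' →L[ℂ] H''} {b : β → H →L[ℂ] H'} (ha : Integrable a μ) (hb : Integrable b ν)
    (ca : Continuous a) (cb : Continuous b) :
    Integrable (fun p : α × β => (a p.1).comp (b p.2)) (μ.prod ν) := by
  have hc : Continuous (fun p : α × β => (a p.1).comp (b p.2)) :=
    (ca.comp continuous_fst).clm_comp (cb.comp continuous_snd)
  exact (ha.norm.mul_prod hb.norm).mono' hc.aestronglyMeasurable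
    (Filter.Eventually.of_forall fun p => ContinuousLinearMap.opNorm_comp_le _ _)

theorem comp_integrable_left {β : Type*} [MeasurableSpace β] {ν : Measure β}
    (a : H' →L[ℂ] H'') {b : β → H →L[ℂ] H'} (hb : Integrable b ν) :
    Integrable (fun p : β => a.comp (b p)) ν :=
  (ContinuousLinearMap.compL ℂ H H' H'' a).integrable_comp hb

theorem comp_integral [CompleteSpace H'] [CompleteSpace H''] {β : Type*} [MeasurableSpace β]
    {ν : Measure β} (a : H' →L[ℂ] H'') {b : β → H →L[ℂ] H'} (hb : Integrable b ν) :
    ∫ p, a.comp (b p) ∂ν = a.comp (∫ p, b p ∂ν) :=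
  (ContinuousLinearMap.compL ℂ H H' H'' a).integral_comp_comm hb

theorem integral_comp_right [CompleteSpace H''] {β : Type*} [MeasurableSpace β]
    {ν : Measure β} {a : β → H' →L[ℂ] H''} (b : H →L[ℂ] H') (ha : Integrable a ν) :
    ∫ p, (a p).comp b ∂ν = (∫ p, a p ∂ν).comp b :=
  ((ContinuousLinearMap.compL ℂ H H' H'').flip b).integral_comp_comm ha

/-- total phase -/
def Phi (ε lam : ℝ) (A : Ed d → Ed d) (x ξ y η z ζ : Ed d) : ℝ :=
  inner ℝ (y + z) ξ - lam * gammaB ε A x y z - inner ℝ η (x - (ε / 2) • z)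
    - inner ℝ ζ (x + (ε / 2) • y)

theorem weyl_eq (ε lam : ℝ) (A : Ed d → Ed d)
    (f : 𝓢(Ed d × Ed d, H' →L[ℂ] H'')) (g : 𝓢(Ed d × Ed d, H →L[ℂ] H')) (x ξ : Ed d)
    (p : (Ed d × Ed d) × (Ed d × Ed d)) :
    weylIntegrand ε lam A f g (x, ξ) p = ex (Phi ε lam A x ξ p.1.1 p.1.2 p.2.1 p.2.2) •
      ((FS d _ f p.1.swap).comp (FS d _ g p.2.swap)) := by
  obtain ⟨⟨y, η⟩, ⟨z, ζ⟩⟩ := p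
  rw [weylIntegrand, fourierSymp_eq, fourierSymp_eq]
  congr 1
  rw [ex, ← Complex.exp_add, ← Complex.exp_add]
  congr 1
  simp only [Phi, symp, inner_add_left, inner_add_right, inner_sub_right, inner_smul_right,
    Prod.fst_add, Prod.snd_add]
  rw [real_inner_comm ξ y, real_inner_comm ξ z, real_inner_comm x η, real_inner_comm x ζ,
    real_inner_comm y ζ]
  push_cast
  ring

theorem gamma_cont (ε : ℝ) {A : Ed d → Ed d} (hA : IsPolyVF A) (x : Ed d) {α : Type*}
    [TopologicalSpace α] {u v : α → Ed d} (hu : Continuous u) (hv : Continuous v) :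
    Continuous fun p => gammaB ε A x (u p) (v p) := by
  have h := (gamma_tg ε hA
    ((ContinuousLinearMap.fst ℝ (Ed d) (Ed d)).comp (ContinuousLinearMap.fst ℝ (Ed d × Ed d) (Ed d)))
    ((ContinuousLinearMap.snd ℝ (Ed d) (Ed d)).comp (ContinuousLinearMap.fst ℝ (Ed d × Ed d) (Ed d)))
    (ContinuousLinearMap.snd ℝ (Ed d × Ed d) (Ed d))).1.continuous
  have h2 : Continuous fun p : α => (((x, u p), v p) : (Ed d × Ed d) × Ed d) := by fun_prop
  have h3 := h.comp h2
  exact h3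

theorem Phi_cont (ε lam : ℝ) {A : Ed d → Ed d} (hA : IsPolyVF A) (x ξ : Ed d) {α : Type*}
    [TopologicalSpace α] {u v w t : α → Ed d} (hu : Continuous u) (hv : Continuous v)
    (hw : Continuous w) (ht : Continuous t) :
    Continuous fun p => Phi ε lam A x ξ (u p) (v p) (w p) (t p) := by
  have := gamma_cont ε hA x hu hw
  unfold Phi
  fun_prop

theorem FSs_int {F : Type*} [NormedAddCommGroup F] [NormedSpace ℂ F] (f : 𝓢(Ed d × Ed d, F)) :
    Integrable (fun p : Ed d × Ed d => f p.swap) volume := by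
  have h : Integrable f ((volume : Measure (Ed d)).prod (volume : Measure (Ed d))) :=
    f.integrable (μ := (volume : Measure (Ed d × Ed d)))
  exact h.swap

theorem weyl_integrable (ε lam : ℝ) {A : Ed d → Ed d} (hA : IsPolyVF A)
    (f : 𝓢(Ed d × Ed d, H' →L[ℂ] H'')) (g : 𝓢(Ed d × Ed d, H →L[ℂ] H')) (x ξ : Ed d) :
    Integrable (weylIntegrand ε lam A f g (x, ξ)) volume := by
  rw [funext (weyl_eq ε lam A f g x ξ)]
  exact integrable_ex_smul (Phi_cont ε lam hA x ξ (by fun_prop) (by fun_prop) (by fun_prop)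
    (by fun_prop)) (comp_prod_integrable (FSs_int _) (FSs_int _)
      ((FS d _ f).continuous.comp continuous_swap) ((FS d _ g).continuous.comp continuous_swap))

theorem ex_split (ε lam : ℝ) (A : Ed d → Ed d) (x ξ y η z ζ : Ed d) :
    ex (Phi ε lam A x ξ y η z ζ) = ex (Phi ε lam A x ξ y η z 0) *
      ex (-inner ℝ ζ (x + (ε / 2) • y)) := by
  rw [← ex_add]
  congr 1
  simp [Phi]
  ring

theorem ex_split2 (ε lam : ℝ) (A : Ed d → Ed d) (x ξ y η z : Ed d) :
    ex (Phi ε lam A x ξ y η z 0) = ex (Phi ε lam A x ξ y 0 z 0) *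
      ex (-inner ℝ η (x - (ε / 2) • z)) := by
  rw [← ex_add]
  congr 1
  simp [Phi]
  ring

variable [CompleteSpace H'] [CompleteSpace H'']

theorem step1 (ε lam : ℝ) {A : Ed d → Ed d} (hA : IsPolyVF A)
    (a : H' →L[ℂ] H'') (g : 𝓢(Ed d × Ed d, H →L[ℂ] H')) (x ξ y η : Ed d) :
    ∫ Z : Ed d × Ed d, ex (Phi ε lam A x ξ y η Z.1 Z.2) • (a.comp (FS d _ g Z.swap)) =
      ((2 * π) ^ d : ℝ) • ∫ z, ex (Phi ε lam A x ξ y η z 0) •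
        (a.comp (KC d _ g (x + (ε / 2) • y, z))) := by
  have hi : Integrable (fun Z : Ed d × Ed d =>
      ex (Phi ε lam A x ξ y η Z.1 Z.2) • (a.comp (FS d _ g Z.swap))) volume :=
    integrable_ex_smul (Phi_cont ε lam hA x ξ (by fun_prop) (by fun_prop) (by fun_prop)
      (by fun_prop)) (comp_integrable_left a (FSs_int _))
  rw [Measure.volume_eq_prod, integral_prod _ hi, ← integral_smul]
  refine integral_congr_ae (Filter.Eventually.of_forall fun z => ?_)
  have e : ∀ ζ : Ed d, ex (Phi ε lam A x ξ y η z ζ) • (a.comp (FS d _ g (ζ, z))) =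
      ex (Phi ε lam A x ξ y η z 0) •
        (a.comp (ex (-inner ℝ ζ (x + (ε / 2) • y)) • FS d _ g (ζ, z))) := by
    intro ζ
    rw [ex_split, mul_smul, ContinuousLinearMap.comp_smul]
  simp only [Prod.swap_prod_mk]
  rw [integral_congr_ae (Filter.Eventually.of_forall e), integral_smul]
  rw [comp_integral a (integrable_ex_smul (by fun_prop) (symb_integrable₁ _ _)), FS_inv,
    ContinuousLinearMap.comp_smul, smul_comm]

theorem step2 (ε lam : ℝ) {A : Ed d → Ed d} (hA : IsPolyVF A)
    (f : 𝓢(Ed d × Ed d, H' →L[ℂ] H'')) (g : 𝓢(Ed d × Ed d, H →L[ℂ] H')) (x ξ y : Ed d) :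
    ∫ η, ∫ z, ex (Phi ε lam A x ξ y η z 0) •
        ((FS d _ f (η, y)).comp (KC d _ g (x + (ε / 2) • y, z))) =
      ((2 * π) ^ d : ℝ) • ∫ z, ex (Phi ε lam A x ξ y 0 z 0) •
        ((KC d _ f (x - (ε / 2) • z, y)).comp (KC d _ g (x + (ε / 2) • y, z))) := by
  have hi : Integrable (uncurry fun η z => ex (Phi ε lam A x ξ y η z 0) •
        ((FS d _ f (η, y)).comp (KC d _ g (x + (ε / 2) • y, z))))
        ((volume : Measure (Ed d)).prod (volume : Measure (Ed d))) :=
    integrable_ex_smul (Phi_cont ε lam hA x ξ (by fun_prop) (by fun_prop) (by fun_prop)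
      (by fun_prop)) (comp_prod_integrable (symb_integrable₁ _ _) (symb_integrable _ _)
        ((FS d _ f).continuous.comp (Continuous.prodMk_left y))
        ((KC d _ g).continuous.comp (Continuous.prodMk_right _)))
  rw [integral_integral_swap hi, ← integral_smul]
  refine integral_congr_ae (Filter.Eventually.of_forall fun z => ?_)
  have e : ∀ η : Ed d, ex (Phi ε lam A x ξ y η z 0) •
        ((FS d _ f (η, y)).comp (KC d _ g (x + (ε / 2) • y, z))) =
      ex (Phi ε lam A x ξ y 0 z 0) • ((ex (-inner ℝ η (x - (ε / 2) • z)) • FS d _ f (η, y)).comp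
        (KC d _ g (x + (ε / 2) • y, z))) := by
    intro η
    rw [ex_split2, mul_smul, ContinuousLinearMap.smul_comp]
  simp only
  rw [integral_congr_ae (Filter.Eventually.of_forall e), integral_smul]
  rw [integral_comp_right _ (integrable_ex_smul (by fun_prop) (symb_integrable₁ _ _)), FS_inv,
    ContinuousLinearMap.smul_comp, smul_comm]

theorem weyl_integral (ε lam : ℝ) {A : Ed d → Ed d} (hA : IsPolyVF A)
    (f : 𝓢(Ed d × Ed d, H' →L[ℂ] H'')) (g : 𝓢(Ed d × Ed d, H →L[ℂ] H')) (x ξ : Ed d) :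
    ∫ p, weylIntegrand ε lam A f g (x, ξ) p = ((2 * π) ^ (2 * d) : ℝ) •
      ∫ y, ∫ z, ex (Phi ε lam A x ξ y 0 z 0) •
        ((KC d _ f (x - (ε / 2) • z, y)).comp (KC d _ g (x + (ε / 2) • y, z))) := by
  have hI : Integrable (weylIntegrand ε lam A f g (x, ξ))
    ((volume : Measure (Ed d × Ed d)).prod (volume : Measure (Ed d × Ed d))) :=
    weyl_integrable ε lam hA f g x ξ
  have h1 : ∀ Y : Ed d × Ed d, ∫ Z : Ed d × Ed d, weylIntegrand ε lam A f g (x, ξ) (Y, Z) =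
      ((2 * π) ^ d : ℝ) • ∫ z, ex (Phi ε lam A x ξ Y.1 Y.2 z 0) •
        ((FS d _ f Y.swap).comp (KC d _ g (x + (ε / 2) • Y.1, z))) := by
    intro Y
    rw [← step1 ε lam hA]
    exact integral_congr_ae (Filter.Eventually.of_forall fun Z => weyl_eq ε lam A f g x ξ (Y, Z))
  have hI2 : Integrable (fun Y : Ed d × Ed d =>
      ∫ Z : Ed d × Ed d, weylIntegrand ε lam A f g (x, ξ) (Y, Z))
      ((volume : Measure (Ed d)).prod (volume : Measure (Ed d))) := hI.integral_prod_left
  have h2 : ∫ p, weylIntegrand ε lam A f g (x, ξ) p =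
      ∫ p, weylIntegrand ε lam A f g (x, ξ) p
        ∂((volume : Measure (Ed d × Ed d)).prod (volume : Measure (Ed d × Ed d))) := rfl
  rw [h2, integral_prod _ hI]
  have h3 : ∫ Y : Ed d × Ed d, ∫ Z : Ed d × Ed d, weylIntegrand ε lam A f g (x, ξ) (Y, Z) =
    ∫ y, ∫ η, ∫ Z : Ed d × Ed d, weylIntegrand ε lam A f g (x, ξ) ((y, η), Z) :=
    integral_prod _ hI2
  rw [h3]
  simp only [h1, integral_smul, Prod.swap_prod_mk, step2 ε lam hA, smul_smul]
  congr 1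
  ring

theorem prodW_formula (ε lam : ℝ) {A : Ed d → Ed d} (hA : IsPolyVF A)
    (f : 𝓢(Ed d × Ed d, H' →L[ℂ] H'')) (g : 𝓢(Ed d × Ed d, H →L[ℂ] H')) (X : Ed d × Ed d) :
    prodW H H' H'' ε lam A f g X = (((2 * Real.pi) ^ (2 * d))⁻¹ : ℝ) •
      ∫ p, weylIntegrand ε lam A f g X p := by
  obtain ⟨x, ξ⟩ := X
  rw [weyl_integral ε lam hA, smul_smul, inv_mul_cancel₀ (by positivity), one_smul, prodW_KI,
    KI_apply]
  simp only [RR_apply, ← integral_smul]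
  have hi : Integrable (uncurry fun w y => ex (inner ℝ w ξ) • QQ ε lam A f g ((x, w), y))
      ((volume : Measure (Ed d)).prod (volume : Measure (Ed d))) :=
    integrable_ex_smul (by fun_prop) (slice3_integrable _ x)
  rw [integral_integral_swap hi]
  refine integral_congr_ae (Filter.Eventually.of_forall fun y => ?_)
  simp only
  rw [← integral_add_left_eq_self _ y]
  refine integral_congr_ae (Filter.Eventually.of_forall fun z => ?_)
  simp only [QQ_apply ε lam hA, add_sub_cancel_left, smul_smul, ← ex_add]
  congr 2
  simp [Phi]
  ring

end Formula
end MW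

theorem statement_4 {d : ℕ} (ε lam : ℝ) (hε : 0 < ε) (hlam : 0 < lam)
    {H H' H'' : Type*}
    [NormedAddCommGroup H] [InnerProductSpace ℂ H] [CompleteSpace H]
    [TopologicalSpace.SeparableSpace H]
    [NormedAddCommGroup H'] [InnerProductSpace ℂ H'] [CompleteSpace H']
    [TopologicalSpace.SeparableSpace H']
    [NormedAddCommGroup H''] [InnerProductSpace ℂ H''] [CompleteSpace H'']
    [TopologicalSpace.SeparableSpace H'']
    (A : Ed d → Ed d) (hA : IsPolyVF A) :
    -- existence and uniqueness of the continuous bilinear magnetic Weyl product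
    (∃! P : SchwartzMap (Ed d × Ed d) (H' →L[ℂ] H'') →L[ℂ]
        SchwartzMap (Ed d × Ed d) (H →L[ℂ] H') →L[ℂ]
        SchwartzMap (Ed d × Ed d) (H →L[ℂ] H''),
      ∀ (f : SchwartzMap (Ed d × Ed d) (H' →L[ℂ] H''))
        (g : SchwartzMap (Ed d × Ed d) (H →L[ℂ] H'))
        (Ψ : SchwartzMap (Ed d) H) (x : Ed d),
        opA ε lam A (⇑(P f g)) (⇑Ψ) x = opA ε lam A (⇑f) (opA ε lam A (⇑g) (⇑Ψ)) x) ∧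
    -- any such product is given by the absolutely convergent integral formula and
    -- depends only on the magnetic field B = dA, not on the vector potential A
    (∀ P : SchwartzMap (Ed d × Ed d) (H' →L[ℂ] H'') →L[ℂ]
        SchwartzMap (Ed d × Ed d) (H →L[ℂ] H') →L[ℂ]
        SchwartzMap (Ed d × Ed d) (H →L[ℂ] H''),
      (∀ (f : SchwartzMap (Ed d × Ed d) (H' →L[ℂ] H''))
        (g : SchwartzMap (Ed d × Ed d) (H →L[ℂ] H'))
        (Ψ : SchwartzMap (Ed d) H) (x : Ed d),
        opA ε lam A (⇑(P f g)) (⇑Ψ) x = opA ε lam A (⇑f) (opA ε lam A (⇑g) (⇑Ψ)) x) →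
      ((∀ (f : SchwartzMap (Ed d × Ed d) (H' →L[ℂ] H''))
          (g : SchwartzMap (Ed d × Ed d) (H →L[ℂ] H'))
          (X : Ed d × Ed d),
          Integrable (weylIntegrand ε lam A (⇑f) (⇑g) X) volume ∧
          P f g X = (((2 * Real.pi) ^ (2 * d))⁻¹ : ℝ) •
            ∫ YZ : (Ed d × Ed d) × (Ed d × Ed d), weylIntegrand ε lam A (⇑f) (⇑g) X YZ) ∧
        (∀ A' : Ed d → Ed d, IsPolyVF A' →
          (∀ (x : Ed d) (j l : Fin d), Bcomp A' x j l = Bcomp A x j l) →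
          ∀ (f : SchwartzMap (Ed d × Ed d) (H' →L[ℂ] H''))
            (g : SchwartzMap (Ed d × Ed d) (H →L[ℂ] H'))
            (Ψ : SchwartzMap (Ed d) H) (x : Ed d),
            opA ε lam A' (⇑(P f g)) (⇑Ψ) x =
              opA ε lam A' (⇑f) (opA ε lam A' (⇑g) (⇑Ψ)) x))) := by
  have inj : ∀ P : SchwartzMap (Ed d × Ed d) (H' →L[ℂ] H'') →L[ℂ]
        SchwartzMap (Ed d × Ed d) (H →L[ℂ] H') →L[ℂ]
        SchwartzMap (Ed d × Ed d) (H →L[ℂ] H''),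
      (∀ (f : SchwartzMap (Ed d × Ed d) (H' →L[ℂ] H''))
        (g : SchwartzMap (Ed d × Ed d) (H →L[ℂ] H'))
        (Ψ : SchwartzMap (Ed d) H) (x : Ed d),
        opA ε lam A (⇑(P f g)) (⇑Ψ) x = opA ε lam A (⇑f) (opA ε lam A (⇑g) (⇑Ψ)) x) →
      ∀ f g, P f g = MW.prodW H H' H'' ε lam A f g := by
    intro P hP f g
    refine MW.opA_inj ε lam hε hA _ _ fun Ψ x => ?_
    rw [hP, MW.opA_comp ε lam hA]
  refine ⟨⟨MW.prodW H H' H'' ε lam A, fun f g Ψ x => MW.opA_comp ε lam hA f g Ψ x, ?_⟩, ?_⟩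
  · intro P hP
    refine ContinuousLinearMap.ext fun f => ContinuousLinearMap.ext fun g => ?_
    exact inj P hP f g
  · intro P hP
    refine ⟨fun f g X => ⟨MW.weyl_integrable ε lam hA f g X.1 X.2, ?_⟩, ?_⟩
    · rw [inj P hP f g]
      exact MW.prodW_formula ε lam hA f g X
    · intro A' hA' hB f g Ψ x
      rw [inj P hP f g, ← MW.prodW_congr ε lam hB]
      exact MW.opA_comp ε lam hA' f g Ψ x

end
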